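/- arXiv:math/0403221 — 4 statements merged into one kernel-verified Lean document; each statement's English description precedes it below -/
import Mathlib

section
/- For n even, n = 2m with m ≥ 2, fix r > 0 and define for s ≥ 0 the averaged function II(r,s) = ⨍_{‖x‖=r} 1/‖x−y‖² dS_x, where y is any point with ‖y‖ = s (the average over the sphere of radius r of the function x ↦ 1/‖x−y‖²). Then there exists a constant C > 0 depending only on n such that |r² · II(r,s) − 1| ≤ C s²/r² whenever s ≤ r. -/
open MeasureTheory

/-- The Euclidean Laplacian of a function on `ℝⁿ`. -/
noncomputable def lap {n : ℕ} (f : EuclideanSpace ℝ (Fin n) → ℝ) :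
    EuclideanSpace ℝ (Fin n) → ℝ :=
  fun x => ∑ i, fderiv ℝ (fun y => fderiv ℝ f y (EuclideanSpace.single i 1)) x
    (EuclideanSpace.single i 1)

/-- The average of `F` over the sphere of radius `r` centered at `c`,
with respect to the `(n-1)`-dimensional Hausdorff (surface) measure. -/
noncomputable def sphereAvg {n : ℕ} (c : EuclideanSpace ℝ (Fin n)) (r : ℝ)
    (F : EuclideanSpace ℝ (Fin n) → ℝ) : ℝ :=
  ⨍ x in Metric.sphere c r, F x ∂(μH[(n : ℝ) - 1])

/-- The constant `Cₙ = 1/(((n-2)!!)² |S^{n-1}|)`. -/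
noncomputable def Cconst (n : ℕ) : ℝ :=
  1 / (((Nat.doubleFactorial (n - 2) : ℝ)) ^ 2 *
    (μH[(n : ℝ) - 1] (Metric.sphere (0 : EuclideanSpace ℝ (Fin n)) 1)).toReal)

open Metric Set Module
open scoped ENNReal NNReal RealInnerProductSpace

/-- Radial projection onto the unit sphere is `2`-Lipschitz outside the open unit ball. -/
lemma norm_inv_smul_sub_le {E : Type*} [NormedAddCommGroup E] [NormedSpace ℝ E] {x y : E}
    (hx : 1 ≤ ‖x‖) (hy : 1 ≤ ‖y‖) : ‖‖x‖⁻¹ • x - ‖y‖⁻¹ • y‖ ≤ 2 * ‖x - y‖ := by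
  have hx0 : 0 < ‖x‖ := by linarith
  have hy0 : 0 < ‖y‖ := by linarith
  have h : ‖x‖⁻¹ • x - ‖y‖⁻¹ • y = ‖x‖⁻¹ • (x - y) + (‖x‖⁻¹ - ‖y‖⁻¹) • y := by
    rw [smul_sub, sub_smul]; abel
  have h1 : ‖‖x‖⁻¹ • (x - y)‖ ≤ ‖x - y‖ := by
    rw [norm_smul, norm_inv, norm_norm]
    exact mul_le_of_le_one_left (norm_nonneg _) (inv_le_one_of_one_le₀ hx)
  have h2 : ‖(‖x‖⁻¹ - ‖y‖⁻¹) • y‖ ≤ ‖x - y‖ := by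
    have h3 : (‖x‖⁻¹ - ‖y‖⁻¹) * ‖y‖ = ‖x‖⁻¹ * (‖y‖ - ‖x‖) := by field_simp
    rw [norm_smul, ← norm_norm y, ← norm_mul, norm_norm, h3, norm_mul, norm_inv, norm_norm]
    refine (mul_le_of_le_one_left (norm_nonneg _) (inv_le_one_of_one_le₀ hx)).trans ?_
    rw [Real.norm_eq_abs, norm_sub_rev]
    exact abs_norm_sub_norm_le _ _
  calc _ ≤ ‖‖x‖⁻¹ • (x - y)‖ + ‖(‖x‖⁻¹ - ‖y‖⁻¹) • y‖ := by rw [h]; exact norm_add_le _ _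
    _ ≤ _ := by linarith

/-- The gnomonic parametrization of the open hemisphere centred at `e`. -/
noncomputable def capMap {E W : Type*} [NormedAddCommGroup E] [InnerProductSpace ℝ E]
    [NormedAddCommGroup W] [InnerProductSpace ℝ W] (e : E) (ι : W →ₗᵢ[ℝ] E) (v : W) : E :=
  ‖e + ι v‖⁻¹ • (e + ι v)

section CapMap

variable {E W : Type*} [NormedAddCommGroup E] [InnerProductSpace ℝ E]
  [NormedAddCommGroup W] [InnerProductSpace ℝ W] {e : E} {ι : W →ₗᵢ[ℝ] E}

lemma norm_add_sq_of_orthogonal (he : ‖e‖ = 1) (hι : ∀ v, ⟪e, ι v⟫ = 0) (v : W) :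
    ‖e + ι v‖ ^ 2 = 1 + ‖v‖ ^ 2 := by
  rw [norm_add_sq_real, hι, he, ι.norm_map]; ring

lemma one_le_norm_add_of_orthogonal (he : ‖e‖ = 1) (hι : ∀ v, ⟪e, ι v⟫ = 0) (v : W) :
    1 ≤ ‖e + ι v‖ := by
  have := norm_add_sq_of_orthogonal he hι v
  nlinarith [norm_nonneg (e + ι v), sq_nonneg ‖v‖]

lemma lipschitzWith_capMap (he : ‖e‖ = 1) (hι : ∀ v, ⟪e, ι v⟫ = 0) :
    LipschitzWith 2 (capMap e ι) := by
  refine LipschitzWith.of_dist_le_mul fun v w => ?_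
  rw [dist_eq_norm, dist_eq_norm]
  refine (norm_inv_smul_sub_le (one_le_norm_add_of_orthogonal he hι v)
    (one_le_norm_add_of_orthogonal he hι w)).trans_eq ?_
  rw [add_sub_add_left_eq_sub, ← map_sub, ι.norm_map]; rfl

lemma exists_capMap_eq (he : ‖e‖ = 1) (hι' : ∀ x, ⟪e, x⟫ = 0 → ∃ v, ι v = x) {u : E}
    (hu : ‖u‖ = 1) (hc : 1 / 2 ≤ ⟪e, u⟫) : ∃ v ∈ ball (0 : W) 2, capMap e ι v = u := by
  set c : ℝ := ⟪e, u⟫ with hcdef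
  have hc0 : 0 < c := by linarith
  obtain ⟨v, hv⟩ := hι' (c⁻¹ • u - e) (by
    rw [inner_sub_right, inner_smul_right, ← hcdef, real_inner_self_eq_norm_sq, he]
    field_simp; norm_num)
  have hsum : e + ι v = c⁻¹ • u := by rw [hv]; abel
  refine ⟨v, ?_, ?_⟩
  · have h1 : ‖v‖ ^ 2 = (c⁻¹) ^ 2 - 1 := by
      rw [← ι.norm_map, hv, norm_sub_sq_real, norm_smul, inner_smul_left, real_inner_comm,
        ← hcdef, hu, he, norm_inv, Real.norm_eq_abs, abs_of_pos hc0]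
      simp only [conj_trivial]; field_simp; ring
    have h2 : c⁻¹ ≤ 2 := by
      rw [inv_le_comm₀ hc0 (by norm_num)]; linarith
    have h3 : 0 < c⁻¹ := by positivity
    rw [mem_ball_zero_iff]
    nlinarith [norm_nonneg v]
  · rw [capMap, hsum, norm_smul, norm_inv, Real.norm_eq_abs, abs_of_pos hc0, hu, smul_smul]
    rw [mul_one, inv_inv, mul_inv_cancel₀ hc0.ne', one_smul]

lemma inv_one_sub_inner_capMap_le (he : ‖e‖ = 1) (hι : ∀ v, ⟪e, ι v⟫ = 0) {v : W}
    (hv : ‖v‖ < 2) : (1 - ⟪e, capMap e ι v⟫)⁻¹ ≤ 10 * (‖v‖ ^ 2)⁻¹ := by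
  have h1 := norm_add_sq_of_orthogonal he hι v
  have h2 := one_le_norm_add_of_orthogonal he hι v
  have h3 : ⟪e, capMap e ι v⟫ = ‖e + ι v‖⁻¹ := by
    rw [capMap, inner_smul_right, inner_add_right, hι, real_inner_self_eq_norm_sq, he]; simp
  rw [h3]
  set N := ‖e + ι v‖
  have hN : 0 < N := by linarith
  rcases eq_or_ne v 0 with rfl | hv0
  · have : N = 1 := by
      simp at h1
      rcases h1 with h | h <;> linarith
    simp [this]
  have hv1 : 0 < ‖v‖ := norm_pos_iff.2 hv0
  have h4 : 1 - N⁻¹ = ‖v‖ ^ 2 / (N * (N + 1)) := by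
    field_simp; nlinarith
  rw [h4, inv_div, div_eq_mul_inv]
  gcongr
  nlinarith

/-- Change of variables inequality for the parametrization `capMap` of a spherical cap. -/
lemma lintegral_cap_le [MeasurableSpace E] [BorelSpace E] [MeasurableSpace W] [BorelSpace W]
    (he : ‖e‖ = 1) (hι : ∀ v, ⟪e, ι v⟫ = 0) (hι' : ∀ x, ⟪e, x⟫ = 0 → ∃ v, ι v = x) {d : ℝ}
    (hd : 0 ≤ d) {f : E → ℝ≥0∞} (hf : Measurable f) :
    ∫⁻ x in sphere 0 1 ∩ {x | 1 / 2 ≤ ⟪e, x⟫}, f x ∂μH[d] ≤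
      2 ^ d * ∫⁻ v in ball (0 : W) 2, f (capMap e ι v) ∂μH[d] := by
  have hL := lipschitzWith_capMap he hι
  have hm : Measurable (capMap e ι) := hL.continuous.measurable
  have key : (μH[d] : Measure E).restrict (sphere 0 1 ∩ {x | 1 / 2 ≤ ⟪e, x⟫}) ≤
      (2 : ℝ≥0∞) ^ d • ((μH[d] : Measure W).restrict (ball 0 2)).map (capMap e ι) := by
    refine Measure.le_iff.2 fun A hA => ?_
    rw [Measure.restrict_apply hA, Measure.smul_apply, Measure.map_apply hm hA,
      Measure.restrict_apply (hm hA), smul_eq_mul]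
    calc _ ≤ μH[d] (capMap e ι '' (capMap e ι ⁻¹' A ∩ ball 0 2)) := by
          refine measure_mono ?_
          rintro x ⟨hxA, hx1, hx2⟩
          obtain ⟨v, hv, rfl⟩ := exists_capMap_eq he hι' (by simpa using hx1) hx2
          exact ⟨v, ⟨hxA, hv⟩, rfl⟩
      _ ≤ _ := by simpa using hL.hausdorffMeasure_image_le hd (capMap e ι ⁻¹' A ∩ ball 0 2)
  calc _ ≤ _ := lintegral_mono' key le_rfl
    _ = _ := by rw [lintegral_smul_measure, lintegral_map hf hm, smul_eq_mul]

end CapMap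

lemma exists_isometry_orthogonal {d : ℕ} (e : EuclideanSpace ℝ (Fin (d + 1))) (he : ‖e‖ = 1) :
    ∃ ι : EuclideanSpace ℝ (Fin d) →ₗᵢ[ℝ] EuclideanSpace ℝ (Fin (d + 1)),
      (∀ v, ⟪e, ι v⟫ = 0) ∧ ∀ x, ⟪e, x⟫ = 0 → ∃ v, ι v = x := by
  have : Fact (finrank ℝ (EuclideanSpace ℝ (Fin (d + 1))) = d + 1) := ⟨by simp⟩
  have he0 : e ≠ 0 := by rintro rfl; simp at he
  let b := OrthonormalBasis.fromOrthogonalSpanSingleton (𝕜 := ℝ) d he0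
  refine ⟨(ℝ ∙ e)ᗮ.subtypeₗᵢ.comp b.repr.symm.toLinearIsometry, fun v => ?_, fun x hx => ?_⟩
  · exact Submodule.mem_orthogonal_singleton_iff_inner_right.1 (b.repr.symm v).2
  · refine ⟨b.repr ⟨x, Submodule.mem_orthogonal_singleton_iff_inner_right.2 hx⟩, ?_⟩
    simp

instance isAddHaarMeasure_hausdorffMeasure_euclideanSpace (d : ℕ) :
    (μH[(d : ℝ)] : Measure (EuclideanSpace ℝ (Fin d))).IsAddHaarMeasure := by
  have h := MeasureTheory.isAddHaarMeasure_hausdorffMeasure (E := EuclideanSpace ℝ (Fin d))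
  rwa [finrank_euclideanSpace_fin] at h

lemma hausdorffMeasure_sphere_lt_top (d : ℕ) :
    μH[(d : ℝ)] (sphere (0 : EuclideanSpace ℝ (Fin (d + 1))) 1) < ∞ := by
  refine (isCompact_sphere _ _).measure_lt_top_of_nhdsWithin fun e he => ?_
  have he : ‖e‖ = 1 := by simpa using he
  obtain ⟨ι, h1, h2⟩ := exists_isometry_orthogonal e he
  have h := lintegral_cap_le he h1 h2 (d := (d : ℝ)) (by positivity) (f := fun _ => 1) (by fun_prop)
  refine ⟨_, Filter.inter_mem self_mem_nhdsWithin (mem_nhdsWithin_of_mem_nhds ?_),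
    lt_of_le_of_lt (by simpa using h) ?_⟩
  · have : ContinuousAt (fun x => ⟪e, x⟫) e := by fun_prop
    refine this.eventually (Ici_mem_nhds ?_)
    beta_reduce
    rw [real_inner_self_eq_norm_sq, he]
    norm_num
  · exact ENNReal.mul_lt_top (by simp) measure_ball_lt_top

lemma hausdorffMeasure_sphere_pos (d : ℕ) :
    0 < μH[(d : ℝ)] (sphere (0 : EuclideanSpace ℝ (Fin (d + 1))) 1) := by
  let e : EuclideanSpace ℝ (Fin (d + 1)) := EuclideanSpace.single 0 1
  have he : ‖e‖ = 1 := by simp [e]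
  have he0 : e ≠ 0 := by intro h; simp [h] at he
  have : Fact (finrank ℝ (EuclideanSpace ℝ (Fin (d + 1))) = d + 1) := ⟨by simp⟩
  have hK : finrank ℝ (ℝ ∙ e)ᗮ = d := Submodule.finrank_orthogonal_span_singleton he0
  have hH := MeasureTheory.isAddHaarMeasure_hausdorffMeasure (E := (ℝ ∙ e)ᗮ)
  rw [hK] at hH
  refine (measure_ball_pos μH[(d : ℝ)] (0 : (ℝ ∙ e)ᗮ) one_pos).trans_le (le_trans
    (measure_mono ?_) ((ℝ ∙ e)ᗮ.lipschitzWith_orthogonalProjectionOnto.hausdorffMeasure_image_le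
      (Nat.cast_nonneg d) (sphere 0 1) |>.trans_eq (by simp)))
  intro x hx
  have hx1 : ‖(x : EuclideanSpace ℝ (Fin (d + 1)))‖ < 1 := by simpa using hx
  have hxe : ⟪(x : EuclideanSpace ℝ (Fin (d + 1))), e⟫ = 0 :=
    Submodule.mem_orthogonal_singleton_iff_inner_left.1 x.2
  refine ⟨x + √(1 - ‖x‖ ^ 2) • e, ?_, ?_⟩
  · rw [mem_sphere_zero_iff_norm, ← sq_eq_sq₀ (norm_nonneg _) zero_le_one, norm_add_sq_real,
      inner_smul_right, hxe, norm_smul, he, Real.norm_eq_abs, mul_one, sq_abs, Real.sq_sqrt]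
    · simp
    · have := norm_nonneg x
      have : ‖x‖ < 1 := hx1
      nlinarith
  · have h0 : (ℝ ∙ e)ᗮ.orthogonalProjectionOnto e = 0 := by
      rw [Submodule.orthogonalProjectionOnto_eq_zero_iff]
      simp
    rw [map_add, map_smul, h0]
    simp

lemma lintegral_ball_inv_norm_sq_lt_top {d : ℕ} (hd : 3 ≤ d) :
    ∫⁻ v in ball (0 : EuclideanSpace ℝ (Fin d)) 2, ENNReal.ofReal (10 * (‖v‖ ^ 2)⁻¹) ∂μH[(d : ℝ)]
      < ∞ := by
  have : Nonempty (Fin d) := ⟨⟨0, by omega⟩⟩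
  have h : IntegrableOn (fun v : EuclideanSpace ℝ (Fin d) => 10 * (‖v‖ ^ 2)⁻¹) (ball 0 2)
      μH[(d : ℝ)] := by
    rw [integrableOn_fun_norm_addHaar μH[(d : ℝ)] (f := fun y : ℝ => 10 * (y ^ 2)⁻¹)]
    have : IntegrableOn (fun y : ℝ => 10 * y ^ (d - 3)) (Ioo 0 2) :=
      (Continuous.integrableOn_Icc (by fun_prop)).mono_set Ioo_subset_Icc_self
    refine this.congr_fun (fun y hy => ?_) measurableSet_Ioo
    obtain ⟨k, rfl⟩ := Nat.exists_eq_add_of_le hd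
    have hy0 : y ≠ 0 := hy.1.ne'
    simp only [finrank_euclideanSpace_fin, smul_eq_mul]
    rw [show 3 + k - 3 = k by omega, show 3 + k - 1 = k + 2 by omega, pow_add]
    field_simp
  exact h.lintegral_lt_top

lemma exists_lintegral_sphere_inv_one_sub_inner_le {d : ℕ} (hd : 3 ≤ d) :
    ∃ K < ∞, ∀ e : EuclideanSpace ℝ (Fin (d + 1)), ‖e‖ = 1 →
      ∫⁻ x in sphere 0 1, ENNReal.ofReal ((1 - ⟪e, x⟫)⁻¹) ∂μH[(d : ℝ)] ≤ K := by
  refine ⟨2 ^ (d : ℝ) * (∫⁻ v in ball (0 : EuclideanSpace ℝ (Fin d)) 2,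
      ENNReal.ofReal (10 * (‖v‖ ^ 2)⁻¹) ∂μH[(d : ℝ)]) +
      2 * μH[(d : ℝ)] (sphere (0 : EuclideanSpace ℝ (Fin (d + 1))) 1), ?_, fun e he => ?_⟩
  · exact ENNReal.add_lt_top.2 ⟨ENNReal.mul_lt_top (by simp)
      (lintegral_ball_inv_norm_sq_lt_top hd),
      ENNReal.mul_lt_top (by simp) (hausdorffMeasure_sphere_lt_top d)⟩
  obtain ⟨ι, h1, h2⟩ := exists_isometry_orthogonal e he
  have hS : MeasurableSet (sphere (0 : EuclideanSpace ℝ (Fin (d + 1))) 1) :=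
    isClosed_sphere.measurableSet
  have hA : MeasurableSet {x : EuclideanSpace ℝ (Fin (d + 1)) | 1 / 2 ≤ ⟪e, x⟫} :=
    (isClosed_le (by fun_prop) (by fun_prop)).measurableSet
  rw [← lintegral_inter_add_sdiff _ _ hA]
  refine add_le_add ?_ ?_
  · refine (lintegral_cap_le he h1 h2 (Nat.cast_nonneg d) (by fun_prop)).trans ?_
    refine mul_le_mul' le_rfl ?_
    refine setLIntegral_mono' measurableSet_ball fun v hv => ENNReal.ofReal_le_ofReal ?_
    exact inv_one_sub_inner_capMap_le he h1 (by simpa using hv)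
  · calc _ ≤ ∫⁻ x in sphere (0 : EuclideanSpace ℝ (Fin (d + 1))) 1 \ {x | 1 / 2 ≤ ⟪e, x⟫},
          2 ∂μH[(d : ℝ)] := by
          refine setLIntegral_mono' (hS.diff hA) fun x hx => ?_
          refine (ENNReal.ofReal_le_ofReal ?_).trans_eq (ENNReal.ofReal_ofNat 2)
          have hx' : ⟪e, x⟫ < 1 / 2 := not_le.1 hx.2
          rw [inv_le_comm₀ (by linarith) (by norm_num)]
          linarith
      _ ≤ _ := by
          rw [setLIntegral_const]
          gcongr
          exact sdiff_subset

/-- Uniform bound for the average of `‖x - y‖⁻²` over the unit sphere, `y` away from the centre. -/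
lemma exists_sphereAvg_inv_norm_sub_sq_le {d : ℕ} (hd : 3 ≤ d) :
    ∃ K : ℝ, 0 ≤ K ∧ ∀ y : EuclideanSpace ℝ (Fin (d + 1)), 1 / 2 ≤ ‖y‖ →
      0 ≤ sphereAvg 0 1 (fun x => (‖x - y‖ ^ 2)⁻¹) ∧
      sphereAvg 0 1 (fun x => (‖x - y‖ ^ 2)⁻¹) ≤ K := by
  obtain ⟨K, hK, h⟩ := exists_lintegral_sphere_inv_one_sub_inner_le hd
  set M := (μH[(d : ℝ)] : Measure (EuclideanSpace ℝ (Fin (d + 1)))).real (sphere 0 1)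
  refine ⟨M⁻¹ * K.toReal, by positivity, fun y hy => ?_⟩
  have hy0 : 0 < ‖y‖ := by linarith
  have hy1 : ‖‖y‖⁻¹ • y‖ = 1 := by rw [norm_smul, norm_inv, norm_norm, inv_mul_cancel₀ hy0.ne']
  have hd1 : ((d + 1 : ℕ) : ℝ) - 1 = d := by simp
  simp only [sphereAvg, hd1]
  rw [setAverage_eq, smul_eq_mul]
  have h0 : 0 ≤ ∫ x in sphere 0 1, (‖x - y‖ ^ 2)⁻¹ ∂μH[(d : ℝ)] :=
    integral_nonneg fun x => by positivity
  refine ⟨mul_nonneg (by positivity) h0, ?_⟩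
  gcongr
  rw [integral_eq_lintegral_of_nonneg_ae (.of_forall fun x => by positivity)
    (by fun_prop : Measurable _).aestronglyMeasurable]
  refine ENNReal.toReal_mono hK.ne (le_trans ?_ (h (‖y‖⁻¹ • y) hy1))
  have hd0 : (0 : ℝ) < d := by
    have : 0 < d := by omega
    exact_mod_cast this
  have := Measure.nullSingletonClass_hausdorff (EuclideanSpace ℝ (Fin (d + 1))) hd0
  have hne : ∀ᵐ x ∂(μH[(d : ℝ)] : Measure (EuclideanSpace ℝ (Fin (d + 1)))), x ≠ ‖y‖⁻¹ • y := by
    simp [ae_iff]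
  refine setLIntegral_mono_ae' isClosed_sphere.measurableSet ?_
  filter_upwards [hne] with x hxy hx
  refine ENNReal.ofReal_le_ofReal ?_
  have hx1 : ‖x‖ = 1 := by simpa using hx
  have h1 : ‖x - y‖ ^ 2 = (1 - ‖y‖) ^ 2 + 2 * ‖y‖ * (1 - ⟪‖y‖⁻¹ • y, x⟫) := by
    rw [norm_sub_sq_real, hx1, inner_smul_left, real_inner_comm]
    simp; field_simp; ring
  have h2 : ⟪‖y‖⁻¹ • y, x⟫ ≤ 1 := by
    refine (real_inner_le_norm _ _).trans ?_
    rw [hy1, hx1, mul_one]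
  have h3 : ⟪‖y‖⁻¹ • y, x⟫ ≠ 1 := fun h3 => hxy
    ((inner_eq_one_iff_of_norm_eq_one (𝕜 := ℝ) hy1 hx1).1 h3).symm
  refine inv_anti₀ (sub_pos.2 (h2.lt_of_ne h3)) ?_
  rw [h1]
  nlinarith [sq_nonneg (1 - ‖y‖)]

/-- Averages over the sphere of radius `r` are averages over the unit sphere of the dilate. -/
lemma sphereAvg_eq_sphereAvg_one {d : ℕ} {r : ℝ} (hr : 0 < r)
    (F : EuclideanSpace ℝ (Fin (d + 1)) → ℝ) :
    sphereAvg 0 r F = sphereAvg 0 1 (fun x => F (r • x)) := by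
  have hd1 : ((d + 1 : ℕ) : ℝ) - 1 = d := by simp
  simp only [sphereAvg, hd1]
  set μ : Measure (EuclideanSpace ℝ (Fin (d + 1))) := μH[(d : ℝ)] with hμ
  have hemb : MeasurableEmbedding (fun x : EuclideanSpace ℝ (Fin (d + 1)) => r • x) :=
    (Homeomorph.smulOfNeZero r hr.ne').measurableEmbedding
  set c : ℝ≥0 := ‖r⁻¹‖₊ ^ (d : ℝ) with hc
  have hc0 : c ≠ 0 := by
    have : ‖r⁻¹‖₊ ≠ 0 := by simpa using hr.ne'
    exact (NNReal.rpow_pos (pos_iff_ne_zero.2 this)).ne'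
  have hmap : μ.map (fun x => r • x) = c • μ := by
    ext A hA
    rw [hemb.map_apply, Set.preimage_smul₀ hr.ne', hμ,
      Measure.hausdorffMeasure_smul₀ (Nat.cast_nonneg d) (inv_ne_zero hr.ne')]
    rfl
  have hpre : (fun x : EuclideanSpace ℝ (Fin (d + 1)) => r • x) ⁻¹' sphere 0 r = sphere 0 1 := by
    ext x
    simp [norm_smul, abs_of_pos hr, hr.ne']
  have hI : ∫ x in sphere 0 1, F (r • x) ∂μ = c * ∫ x in sphere 0 r, F x ∂μ := by
    rw [← hpre, ← hemb.setIntegral_map, hmap, Measure.restrict_smul, integral_smul_nnreal_measure]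
    rfl
  have hM : μ.real (sphere 0 1) = c * μ.real (sphere 0 r) := by
    rw [← hpre, measureReal_def, ← hemb.map_apply, hmap]
    simp [measureReal_def]
  rw [setAverage_eq, setAverage_eq, hI, hM, smul_eq_mul, smul_eq_mul]
  have : (c : ℝ) ≠ 0 := by exact_mod_cast hc0
  rw [mul_inv]
  field_simp

lemma abs_inv_add_inv_sub_two_le {s t : ℝ} (hs : 0 ≤ s) (hs' : s ≤ 1 / 2) (ht : |t| ≤ s) :
    |(1 + s ^ 2 - 2 * t)⁻¹ + (1 + s ^ 2 + 2 * t)⁻¹ - 2| ≤ 16 * s ^ 2 := by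
  obtain ⟨h1, h2⟩ := abs_le.1 ht
  have hp : 1 / 4 ≤ 1 + s ^ 2 - 2 * t := by nlinarith [sq_nonneg (1 - s)]
  have hq : 1 / 4 ≤ 1 + s ^ 2 + 2 * t := by nlinarith [sq_nonneg (1 - s)]
  have htt : t ^ 2 ≤ s ^ 2 := sq_le_sq' h1 h2
  have hs2 : s ^ 2 ≤ 1 / 4 := by nlinarith
  have hD : 1 / 2 ≤ (1 + s ^ 2 - 2 * t) * (1 + s ^ 2 + 2 * t) := by nlinarith
  have key : (1 + s ^ 2 - 2 * t)⁻¹ + (1 + s ^ 2 + 2 * t)⁻¹ - 2 =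
      2 * (4 * t ^ 2 - (1 + s ^ 2) * s ^ 2) / ((1 + s ^ 2 - 2 * t) * (1 + s ^ 2 + 2 * t)) := by
    have : 1 + s ^ 2 - 2 * t ≠ 0 := by linarith
    have : 1 + s ^ 2 + 2 * t ≠ 0 := by linarith
    field_simp; ring
  have hN : |2 * (4 * t ^ 2 - (1 + s ^ 2) * s ^ 2)| ≤ 8 * s ^ 2 :=
    abs_le.2 ⟨by nlinarith [sq_nonneg t], by nlinarith [sq_nonneg s, sq_nonneg (s ^ 2)]⟩
  rw [key, abs_div, abs_of_pos (by linarith : 0 < (1 + s ^ 2 - 2 * t) * (1 + s ^ 2 + 2 * t)),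
    div_le_iff₀ (by linarith)]
  nlinarith [sq_nonneg s]

lemma abs_sphereAvg_inv_norm_sub_sq_sub_one_le {d : ℕ} {y : EuclideanSpace ℝ (Fin (d + 1))}
    (hy : ‖y‖ ≤ 1 / 2) :
    |sphereAvg 0 1 (fun x => (‖x - y‖ ^ 2)⁻¹) - 1| ≤ 8 * ‖y‖ ^ 2 := by
  have hd1 : ((d + 1 : ℕ) : ℝ) - 1 = d := by simp
  simp only [sphereAvg, hd1]
  set μ : Measure (EuclideanSpace ℝ (Fin (d + 1))) := μH[(d : ℝ)] with hμ
  set S : Set (EuclideanSpace ℝ (Fin (d + 1))) := sphere 0 1 with hS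
  have hS' : MeasurableSet S := isClosed_sphere.measurableSet
  have hfin : μ S < ∞ := hausdorffMeasure_sphere_lt_top d
  have hM : 0 < μ.real S :=
    ENNReal.toReal_pos (hausdorffMeasure_sphere_pos d).ne' hfin.ne
  have hInt (z : EuclideanSpace ℝ (Fin (d + 1))) (hz : ‖z‖ ≤ 1 / 2) :
      IntegrableOn (fun x => (‖x - z‖ ^ 2)⁻¹) S μ := by
    refine Measure.integrableOn_of_bounded (M := 4) hfin.ne
      (by fun_prop : Measurable _).aestronglyMeasurable ?_
    refine (ae_restrict_mem hS').mono fun x hx => ?_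
    have hx1 : ‖x‖ = 1 := by simpa [hS] using hx
    have : 1 / 2 ≤ ‖x - z‖ := by linarith [norm_sub_norm_le x z]
    rw [Real.norm_eq_abs, abs_of_nonneg (by positivity), inv_le_comm₀ (by positivity) (by norm_num)]
    nlinarith
  have hneg : ∫ x in S, (‖x - y‖ ^ 2)⁻¹ ∂μ = ∫ x in S, (‖x + y‖ ^ 2)⁻¹ ∂μ := by
    have hmp := (LinearIsometryEquiv.neg ℝ
      (E := EuclideanSpace ℝ (Fin (d + 1)))).toIsometryEquiv.measurePreserving_hausdorffMeasure d
    have h := hmp.setIntegral_preimage_emb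
      (LinearIsometryEquiv.neg ℝ
        (E := EuclideanSpace ℝ (Fin (d + 1)))).toHomeomorph.measurableEmbedding
      (fun x => (‖x - y‖ ^ 2)⁻¹) S
    rw [← h]
    have hpre : (LinearIsometryEquiv.neg ℝ
        (E := EuclideanSpace ℝ (Fin (d + 1)))).toIsometryEquiv ⁻¹' S = S := by
      ext x; simp [hS]
    rw [hpre]
    refine setIntegral_congr_fun hS' fun x _ => ?_
    have : ‖-x - y‖ = ‖x + y‖ := by rw [← norm_neg]; congr 1; abel
    simp [this]
  have hInt1 := hInt y hy
  have hInt2 : IntegrableOn (fun x => (‖x + y‖ ^ 2)⁻¹) S μ := by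
    simpa using hInt (-y) (by simpa using hy)
  have hconst : IntegrableOn (fun _ => (2 : ℝ)) S μ := integrableOn_const hfin.ne
  have hsum : ∫ x in S, ((‖x - y‖ ^ 2)⁻¹ + (‖x + y‖ ^ 2)⁻¹ - 2) ∂μ =
      2 * ∫ x in S, (‖x - y‖ ^ 2)⁻¹ ∂μ - 2 * μ.real S := by
    rw [integral_sub (by exact hInt1.add hInt2) hconst, integral_add hInt1 hInt2, ← hneg,
      setIntegral_const, smul_eq_mul]
    ring
  have hbound := norm_setIntegral_le_of_norm_le_const (μ := μ) (s := S) (C := 16 * ‖y‖ ^ 2)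
    (f := fun x => (‖x - y‖ ^ 2)⁻¹ + (‖x + y‖ ^ 2)⁻¹ - 2) hfin fun x hx => by
      have hx1 : ‖x‖ = 1 := by simpa [hS] using hx
      have h := abs_inv_add_inv_sub_two_le (norm_nonneg y) hy (t := ⟪x, y⟫)
        ((abs_real_inner_le_norm x y).trans_eq (by rw [hx1, one_mul]))
      rw [norm_sub_sq_real, norm_add_sq_real, hx1, Real.norm_eq_abs]
      convert h using 5 <;> ring
  rw [hsum, Real.norm_eq_abs] at hbound
  rw [setAverage_eq, smul_eq_mul]
  set I := ∫ x in S, (‖x - y‖ ^ 2)⁻¹ ∂μ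
  have h1 : (μ.real S)⁻¹ * I - 1 = (2 * I - 2 * μ.real S) / (2 * μ.real S) := by
    field_simp
  rw [h1, abs_div, abs_of_pos (by positivity : 0 < 2 * μ.real S), div_le_iff₀ (by positivity)]
  linarith

/-- Kernel estimate for the spherical average `II(r,s) = ⨍_{‖x‖=r} ‖x-y‖⁻² dS`
in the regime `s = ‖y‖ ≤ r`. -/
theorem stmt_2 {m n : ℕ} (hm : 2 ≤ m) (hn : n = 2 * m) :
    ∃ C > (0 : ℝ), ∀ r > (0 : ℝ), ∀ y : EuclideanSpace ℝ (Fin n), ‖y‖ ≤ r →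
      |r ^ 2 * sphereAvg (0 : EuclideanSpace ℝ (Fin n)) r (fun x => (‖x - y‖ ^ 2)⁻¹) - 1|
        ≤ C * ‖y‖ ^ 2 / r ^ 2 := by
  subst hn
  obtain ⟨d, hd⟩ : ∃ d, 2 * m = d + 1 := ⟨2 * m - 1, by omega⟩
  rw [hd]
  obtain ⟨K, hK, h⟩ := exists_sphereAvg_inv_norm_sub_sq_le (d := d) (by omega)
  refine ⟨4 * (K + 1) + 8, by positivity, fun r hr y hy => ?_⟩
  have hz : ‖r⁻¹ • y‖ = ‖y‖ / r := by
    rw [norm_smul, norm_inv, Real.norm_eq_abs, abs_of_pos hr, inv_mul_eq_div]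
  have hscale : r ^ 2 * sphereAvg 0 r (fun x => (‖x - y‖ ^ 2)⁻¹) =
      sphereAvg 0 1 (fun x => (‖x - r⁻¹ • y‖ ^ 2)⁻¹) := by
    have hx (x : EuclideanSpace ℝ (Fin (d + 1))) :
        (‖r • x - y‖ ^ 2)⁻¹ = (r ^ 2)⁻¹ * (‖x - r⁻¹ • y‖ ^ 2)⁻¹ := by
      have : r • x - y = r • (x - r⁻¹ • y) := by rw [smul_sub, smul_inv_smul₀ hr.ne']
      rw [this, norm_smul, mul_pow, Real.norm_eq_abs, sq_abs, mul_inv]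
    rw [sphereAvg_eq_sphereAvg_one hr]
    simp only [sphereAvg, hx, setAverage_eq, smul_eq_mul, integral_const_mul]
    field_simp
  have hC : (4 * (K + 1) + 8) * ‖y‖ ^ 2 / r ^ 2 = (4 * (K + 1) + 8) * ‖r⁻¹ • y‖ ^ 2 := by
    rw [hz, div_pow, mul_div_assoc]
  rw [hscale, hC]
  set z := r⁻¹ • y
  have hz2 := sq_nonneg ‖z‖
  rcases le_total ‖z‖ (1 / 2) with hz' | hz'
  · refine (abs_sphereAvg_inv_norm_sub_sq_sub_one_le hz').trans ?_
    gcongr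
    linarith
  · obtain ⟨h0, h1⟩ := h z hz'
    have h4 : 1 ≤ 4 * ‖z‖ ^ 2 := by nlinarith
    have h5 : K + 1 ≤ (4 * (K + 1) + 8) * ‖z‖ ^ 2 := by nlinarith
    exact (abs_le.2 ⟨by linarith, by linarith⟩ : |_| ≤ K + 1).trans h5
end

section
/- Let n be even and f ∈ L¹(ℝⁿ) rotationally symmetric, and v(x) = Cₙ ∫_{ℝⁿ} log(‖y‖/‖x−y‖) f(y) dy, written as V(r) for r = ‖x‖. Then lim_{r→0} r V'(r) = 0. -/
open MeasureTheory

section CircleMean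

variable {E : Type*} [NormedAddCommGroup E] [InnerProductSpace ℝ E]

/-- The point at angle `θ` on the unit circle of the plane spanned by `e₁` and `e₂`. -/
noncomputable def planeCircle (e₁ e₂ : E) (θ : ℝ) : E := Real.cos θ • e₁ + Real.sin θ • e₂

/-- The coordinates of the projection of `y` to the plane spanned by `e₁` and `e₂`. -/
noncomputable def planeProj (e₁ e₂ y : E) : ℂ := ⟨inner ℝ e₁ y, inner ℝ e₂ y⟩

/-- The point of the complex plane whose coordinates are the norms of the components of `y`
in the plane spanned by `e₁` and `e₂` and in its orthogonal complement. -/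
noncomputable def planeSplit (e₁ e₂ y : E) : ℂ :=
  ⟨‖planeProj e₁ e₂ y‖, √(‖y‖ ^ 2 - ‖planeProj e₁ e₂ y‖ ^ 2)⟩

/-- The geometric mean of `‖x - y‖` over the circle of radius `r` in the plane spanned by `e₁`
and `e₂`. -/
noncomputable def circleMean (e₁ e₂ : E) (r : ℝ) (y : E) : ℝ :=
  (‖(r : ℂ) + planeSplit e₁ e₂ y‖ + ‖(r : ℂ) - planeSplit e₁ e₂ y‖) / 2

lemma continuous_planeCircle (e₁ e₂ : E) : Continuous (planeCircle e₁ e₂) := by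
  unfold planeCircle
  fun_prop

lemma le_circleMean (e₁ e₂ : E) (r : ℝ) (y : E) : r ≤ circleMean e₁ e₂ r y := by
  have h := norm_add_le ((r : ℂ) + planeSplit e₁ e₂ y) ((r : ℂ) - planeSplit e₁ e₂ y)
  rw [add_add_sub_cancel, ← two_mul, norm_mul, Complex.norm_real, Complex.norm_two] at h
  have := Real.le_norm_self r
  unfold circleMean
  linarith

lemma circleMean_pos (e₁ e₂ : E) {r : ℝ} (hr : 0 < r) (y : E) : 0 < circleMean e₁ e₂ r y :=
  hr.trans_le (le_circleMean e₁ e₂ r y)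

lemma abs_circleMean_sub_le (e₁ e₂ : E) (r s : ℝ) (y : E) :
    |circleMean e₁ e₂ r y - circleMean e₁ e₂ s y| ≤ |r - s| := by
  have h₁ := abs_norm_sub_norm_le ((r : ℂ) + planeSplit e₁ e₂ y) ((s : ℂ) + planeSplit e₁ e₂ y)
  have h₂ := abs_norm_sub_norm_le ((r : ℂ) - planeSplit e₁ e₂ y) ((s : ℂ) - planeSplit e₁ e₂ y)
  rw [add_sub_add_right_eq_sub, ← Complex.ofReal_sub, Complex.norm_real, Real.norm_eq_abs] at h₁
  rw [sub_sub_sub_cancel_right, ← Complex.ofReal_sub, Complex.norm_real, Real.norm_eq_abs] at h₂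
  rw [abs_le] at h₁ h₂ ⊢
  unfold circleMean
  constructor <;> linarith [h₁.1, h₁.2, h₂.1, h₂.2]

lemma sq_norm_planeProj (e₁ e₂ y : E) :
    ‖planeProj e₁ e₂ y‖ ^ 2 = inner ℝ e₁ y ^ 2 + inner ℝ e₂ y ^ 2 := by
  rw [Complex.sq_norm, Complex.normSq_apply, planeProj]
  ring

variable {e₁ e₂ : E} (h₁ : ‖e₁‖ = 1) (h₂ : ‖e₂‖ = 1) (h₁₂ : inner ℝ e₁ e₂ = 0)

include h₁ h₂ h₁₂

lemma norm_planeCircle (θ : ℝ) : ‖planeCircle e₁ e₂ θ‖ = 1 := by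
  have : ‖planeCircle e₁ e₂ θ‖ ^ 2 = 1 := by
    rw [planeCircle, norm_add_sq_real]
    simp [norm_smul, h₁, h₂, h₁₂, inner_smul_left, inner_smul_right]
  nlinarith [norm_nonneg (planeCircle e₁ e₂ θ)]

lemma norm_planeProj_le (y : E) : ‖planeProj e₁ e₂ y‖ ^ 2 ≤ ‖y‖ ^ 2 := by
  have h := sq_nonneg ‖y - ((inner ℝ e₁ y : ℝ) • e₁ + (inner ℝ e₂ y : ℝ) • e₂)‖
  rw [norm_sub_sq_real, norm_add_sq_real] at h
  simp only [norm_smul, h₁, h₂, h₁₂, inner_smul_left, inner_smul_right, inner_add_right,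
    real_inner_comm e₁ y, real_inner_comm e₂ y, Real.norm_eq_abs, mul_one, sq_abs, mul_zero] at h
  rw [sq_norm_planeProj]
  nlinarith

lemma norm_planeSplit (y : E) : ‖planeSplit e₁ e₂ y‖ = ‖y‖ := by
  have h := norm_planeProj_le h₁ h₂ h₁₂ y
  have : ‖planeSplit e₁ e₂ y‖ ^ 2 = ‖y‖ ^ 2 := by
    rw [Complex.sq_norm, Complex.normSq_apply, planeSplit, Real.mul_self_sqrt (by linarith)]
    ring
  exact (pow_left_inj₀ (norm_nonneg _) (norm_nonneg _) two_ne_zero).1 this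

lemma norm_le_circleMean (r : ℝ) (y : E) : ‖y‖ ≤ circleMean e₁ e₂ r y := by
  have h := norm_sub_le ((r : ℂ) + planeSplit e₁ e₂ y) ((r : ℂ) - planeSplit e₁ e₂ y)
  rw [add_sub_sub_cancel, ← two_mul, norm_mul, norm_planeSplit h₁ h₂ h₁₂, Complex.norm_two] at h
  unfold circleMean
  linarith

lemma circleMean_sq_mul (r : ℝ) (y : E) :
    (circleMean e₁ e₂ r y ^ 2) ^ 2 + (r * ‖planeProj e₁ e₂ y‖) ^ 2 =
      circleMean e₁ e₂ r y ^ 2 * (r ^ 2 + ‖y‖ ^ 2) := by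
  have ha : ‖(r : ℂ) + planeSplit e₁ e₂ y‖ ^ 2 =
      r ^ 2 + 2 * (r * ‖planeProj e₁ e₂ y‖) + ‖y‖ ^ 2 := by
    rw [← norm_planeSplit h₁ h₂ h₁₂ y]
    simp only [Complex.sq_norm, Complex.normSq_apply, planeSplit, Complex.add_re, Complex.add_im,
      Complex.ofReal_re, Complex.ofReal_im]
    ring
  have hb : ‖(r : ℂ) - planeSplit e₁ e₂ y‖ ^ 2 =
      r ^ 2 - 2 * (r * ‖planeProj e₁ e₂ y‖) + ‖y‖ ^ 2 := by
    rw [← norm_planeSplit h₁ h₂ h₁₂ y]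
    simp only [Complex.sq_norm, Complex.normSq_apply, planeSplit, Complex.sub_re, Complex.sub_im,
      Complex.ofReal_re, Complex.ofReal_im]
    ring
  unfold circleMean
  set a := ‖(r : ℂ) + planeSplit e₁ e₂ y‖
  set b := ‖(r : ℂ) - planeSplit e₁ e₂ y‖
  have h₃ : r * ‖planeProj e₁ e₂ y‖ = (a ^ 2 - b ^ 2) / 4 := by linarith
  have h₄ : r ^ 2 + ‖y‖ ^ 2 = (a ^ 2 + b ^ 2) / 2 := by linarith
  rw [h₃, h₄]
  ring

lemma norm_smul_planeCircle_sub {r : ℝ} (hr : 0 < r) (y : E) (θ : ℝ) :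
    ‖r • planeCircle e₁ e₂ θ - y‖ = ‖circleMap 0 (circleMean e₁ e₂ r y) θ -
      ((r / circleMean e₁ e₂ r y : ℝ) : ℂ) * planeProj e₁ e₂ y‖ := by
  have hp := circleMean_pos e₁ e₂ hr y
  have key := circleMean_sq_mul h₁ h₂ h₁₂ r y
  set p := circleMean e₁ e₂ r y
  refine (pow_left_inj₀ (norm_nonneg _) (norm_nonneg _) two_ne_zero).1 ?_
  rw [mul_pow, sq_norm_planeProj] at key
  rw [norm_sub_sq_real, norm_smul, norm_planeCircle h₁ h₂ h₁₂, Complex.sq_norm,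
    Complex.normSq_apply, circleMap_zero, Complex.exp_ofReal_mul_I]
  have hc := Real.sin_sq_add_cos_sq θ
  simp only [planeCircle, planeProj, inner_smul_left, inner_add_left, Complex.sub_re,
    Complex.sub_im, Complex.mul_re, Complex.mul_im, Complex.add_re, Complex.add_im,
    Complex.ofReal_re, Complex.ofReal_im, Complex.I_re, Complex.I_im, conj_trivial,
    Real.norm_eq_abs, mul_one, sq_abs]
  field_simp
  linear_combination (-1) * key - p ^ 4 * hc

lemma norm_div_circleMean_mul_le {r : ℝ} (hr : 0 < r) (y : E) :
    ‖((r / circleMean e₁ e₂ r y : ℝ) : ℂ) * planeProj e₁ e₂ y‖ ≤ circleMean e₁ e₂ r y := by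
  have hp := circleMean_pos e₁ e₂ hr y
  rw [norm_mul, Complex.norm_real, Real.norm_of_nonneg (by positivity), div_mul_eq_mul_div,
    div_le_iff₀ hp]
  exact mul_le_mul (le_circleMean e₁ e₂ r y)
    ((abs_le_of_sq_le_sq' (norm_planeProj_le h₁ h₂ h₁₂ y) (norm_nonneg _)).2.trans
      (norm_le_circleMean h₁ h₂ h₁₂ r y)) (norm_nonneg _) hp.le

lemma intervalIntegrable_log_norm_planeCircle {r : ℝ} (hr : 0 < r) (y : E) :
    IntervalIntegrable (fun θ => Real.log ‖r • planeCircle e₁ e₂ θ - y‖) volume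
      0 (2 * Real.pi) := by
  simp_rw [norm_smul_planeCircle_sub h₁ h₂ h₁₂ hr]
  exact circleIntegrable_log_norm_sub_const (c := 0) (circleMean e₁ e₂ r y)

lemma integral_log_norm_planeCircle {r : ℝ} (hr : 0 < r) (y : E) :
    ∫ θ in 0..2 * Real.pi, Real.log ‖r • planeCircle e₁ e₂ θ - y‖ =
      2 * Real.pi * Real.log (circleMean e₁ e₂ r y) := by
  have hp := circleMean_pos e₁ e₂ hr y
  have h := circleAverage_log_norm_sub_const_of_mem_closedBall (c := 0)
    (R := circleMean e₁ e₂ r y) (a := ((r / circleMean e₁ e₂ r y : ℝ) : ℂ) * planeProj e₁ e₂ y)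
    (by simpa only [Metric.mem_closedBall, dist_zero_right, abs_of_pos hp] using
      norm_div_circleMean_mul_le h₁ h₂ h₁₂ hr y)
  rw [Real.circleAverage_def, smul_eq_mul, inv_mul_eq_iff_eq_mul₀ (by positivity)] at h
  simp_rw [norm_smul_planeCircle_sub h₁ h₂ h₁₂ hr]
  exact h

omit h₁ h₂ h₁₂

lemma abs_log_sub_log_le {a b m : ℝ} (hm : 0 < m) (ha : m ≤ a) (hb : m ≤ b) :
    |Real.log a - Real.log b| ≤ |a - b| / m := by
  have key : ∀ {a b : ℝ}, m ≤ a → m ≤ b → Real.log a - Real.log b ≤ |a - b| / m := by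
    intro a b ha hb
    have hb' := hm.trans_le hb
    have ha' := hm.trans_le ha
    rw [← Real.log_div ha'.ne' hb'.ne']
    calc Real.log (a / b) ≤ a / b - 1 := Real.log_le_sub_one_of_pos (by positivity)
      _ = (a - b) / b := by field_simp
      _ ≤ |a - b| / b := by gcongr; exact le_abs_self _
      _ ≤ |a - b| / m := by gcongr
  rw [abs_sub_le_iff]
  exact ⟨key ha hb, abs_sub_comm a b ▸ key hb ha⟩

end CircleMean

section LogPotential

variable {E : Type*} [NormedAddCommGroup E] [InnerProductSpace ℝ E] {e₁ e₂ : E}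

section Integrals

variable (h₁ : ‖e₁‖ = 1) (h₂ : ‖e₂‖ = 1) (h₁₂ : inner ℝ e₁ e₂ = 0)

include h₁ h₂ h₁₂

lemma smul_planeCircle_sub_ne_zero {r : ℝ} (hr : 0 < r) {y : E} (hyr : ‖y‖ ≠ r) (θ : ℝ) :
    r • planeCircle e₁ e₂ θ - y ≠ 0 := by
  intro h
  rw [sub_eq_zero] at h
  rw [← h, norm_smul, norm_planeCircle h₁ h₂ h₁₂, Real.norm_of_nonneg hr.le, mul_one] at hyr
  exact hyr rfl

lemma log_div_norm_planeCircle {r : ℝ} (hr : 0 < r) {y : E} (hy : y ≠ 0) (hyr : ‖y‖ ≠ r) (θ : ℝ) :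
    Real.log (‖y‖ / ‖r • planeCircle e₁ e₂ θ - y‖) =
      Real.log ‖y‖ - Real.log ‖r • planeCircle e₁ e₂ θ - y‖ :=
  Real.log_div (norm_ne_zero_iff.2 hy)
    (norm_ne_zero_iff.2 (smul_planeCircle_sub_ne_zero h₁ h₂ h₁₂ hr hyr θ))

lemma intervalIntegrable_log_div {r : ℝ} (hr : 0 < r) {y : E} (hy : y ≠ 0) (hyr : ‖y‖ ≠ r) :
    IntervalIntegrable (fun θ => Real.log (‖y‖ / ‖r • planeCircle e₁ e₂ θ - y‖)) volume
      0 (2 * Real.pi) := by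
  simp_rw [log_div_norm_planeCircle h₁ h₂ h₁₂ hr hy hyr]
  exact intervalIntegrable_const.sub (intervalIntegrable_log_norm_planeCircle h₁ h₂ h₁₂ hr y)

lemma integral_log_div {r : ℝ} (hr : 0 < r) {y : E} (hy : y ≠ 0) (hyr : ‖y‖ ≠ r) :
    ∫ θ in 0..2 * Real.pi, Real.log (‖y‖ / ‖r • planeCircle e₁ e₂ θ - y‖) =
      2 * Real.pi * (Real.log ‖y‖ - Real.log (circleMean e₁ e₂ r y)) := by
  simp_rw [log_div_norm_planeCircle h₁ h₂ h₁₂ hr hy hyr]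
  rw [intervalIntegral.integral_sub intervalIntegrable_const
    (intervalIntegrable_log_norm_planeCircle h₁ h₂ h₁₂ hr y),
    integral_log_norm_planeCircle h₁ h₂ h₁₂ hr, intervalIntegral.integral_const, smul_eq_mul]
  ring

lemma integral_abs_log_div_le {r : ℝ} (hr : 0 < r) {y : E} (hy : y ≠ 0) (hyr : ‖y‖ ≠ r) :
    ∫ θ in 0..2 * Real.pi, |Real.log (‖y‖ / ‖r • planeCircle e₁ e₂ θ - y‖)| ≤
      4 * Real.pi * Real.log (1 + r / ‖y‖) := by
  have hy' : 0 < ‖y‖ := norm_pos_iff.2 hy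
  have hL : 0 ≤ Real.log (1 + r / ‖y‖) :=
    Real.log_nonneg (le_add_of_nonneg_right (by positivity))
  have hint := intervalIntegrable_log_div h₁ h₂ h₁₂ hr hy hyr
  have hpt : ∀ θ, |Real.log (‖y‖ / ‖r • planeCircle e₁ e₂ θ - y‖)| ≤
      2 * Real.log (1 + r / ‖y‖) + Real.log (‖y‖ / ‖r • planeCircle e₁ e₂ θ - y‖) := by
    intro θ
    have hu := norm_pos_iff.2 (smul_planeCircle_sub_ne_zero h₁ h₂ h₁₂ hr hyr θ)
    have hle : -Real.log (‖y‖ / ‖r • planeCircle e₁ e₂ θ - y‖) ≤ Real.log (1 + r / ‖y‖) := by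
      rw [← Real.log_inv, inv_div]
      refine Real.log_le_log (by positivity) ?_
      rw [div_le_iff₀ hy', add_mul, one_mul, div_mul_cancel₀ _ hy'.ne', add_comm]
      refine (norm_sub_le _ _).trans_eq ?_
      rw [norm_smul, norm_planeCircle h₁ h₂ h₁₂, Real.norm_of_nonneg hr.le, mul_one]
    rw [abs_le]
    constructor <;> linarith
  calc ∫ θ in 0..2 * Real.pi, |Real.log (‖y‖ / ‖r • planeCircle e₁ e₂ θ - y‖)|
      ≤ ∫ θ in 0..2 * Real.pi, (2 * Real.log (1 + r / ‖y‖) +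
          Real.log (‖y‖ / ‖r • planeCircle e₁ e₂ θ - y‖)) :=
        intervalIntegral.integral_mono (by positivity) hint.abs (intervalIntegrable_const.add hint)
          hpt
    _ = 4 * Real.pi * Real.log (1 + r / ‖y‖) +
          2 * Real.pi * (Real.log ‖y‖ - Real.log (circleMean e₁ e₂ r y)) := by
        rw [intervalIntegral.integral_add intervalIntegrable_const hint,
          integral_log_div h₁ h₂ h₁₂ hr hy hyr, intervalIntegral.integral_const, smul_eq_mul]
        ring
    _ ≤ 4 * Real.pi * Real.log (1 + r / ‖y‖) := by
        have := Real.log_le_log hy' (norm_le_circleMean h₁ h₂ h₁₂ r y)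
        have := mul_nonneg Real.two_pi_pos.le (sub_nonneg.2 this)
        linarith

end Integrals

variable [FiniteDimensional ℝ E] [MeasurableSpace E] [BorelSpace E] {μ : Measure E}
  {f : E → ℝ}

omit [InnerProductSpace ℝ E] [FiniteDimensional ℝ E] in
lemma integrable_log_one_add_div_mul (hf : Integrable f μ) {x : E} (hx : x ≠ 0)
    (hint : Integrable (fun y => Real.log (‖y‖ / ‖x - y‖) * f y) μ) {r : ℝ} (hr : 0 < r) :
    Integrable (fun y => Real.log (1 + r / ‖y‖) * f y) μ := by
  have hx' := norm_pos_iff.2 hx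
  have hK : 0 ≤ Real.log (1 + 2 * r / ‖x‖) :=
    Real.log_nonneg (le_add_of_nonneg_right (by positivity))
  have hm : Measurable fun y : E => Real.log (1 + r / ‖y‖) := by fun_prop
  refine ((hf.norm.const_mul (Real.log (1 + 2 * r / ‖x‖))).add hint.norm).mono'
    (hm.aestronglyMeasurable.mul hf.1) (.of_forall fun y => ?_)
  have key : |Real.log (1 + r / ‖y‖)| ≤
      Real.log (1 + 2 * r / ‖x‖) + |Real.log (‖y‖ / ‖x - y‖)| := by
    have hL : 0 ≤ Real.log (1 + r / ‖y‖) :=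
      Real.log_nonneg (le_add_of_nonneg_right (by positivity))
    rw [abs_of_nonneg hL]
    rcases eq_or_ne y 0 with rfl | hy
    · simpa using hK
    have hy' := norm_pos_iff.2 hy
    rcases le_or_gt (‖x‖ / 2) ‖y‖ with h | h
    · have : Real.log (1 + r / ‖y‖) ≤ Real.log (1 + 2 * r / ‖x‖) := by
        refine Real.log_le_log (by positivity) ?_
        gcongr 1 + ?_
        rw [div_le_div_iff₀ hy' hx']
        nlinarith
      linarith [abs_nonneg (Real.log (‖y‖ / ‖x - y‖))]
    · have hu : ‖x‖ / 2 ≤ ‖x - y‖ := by linarith [norm_sub_norm_le x y]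
      have hu' : 0 < ‖x - y‖ := by linarith
      have hsplit : Real.log (1 + r / ‖y‖) =
          Real.log ((‖y‖ + r) / ‖x - y‖) - Real.log (‖y‖ / ‖x - y‖) := by
        rw [← Real.log_div (by positivity) (by positivity)]
        congr 1
        field_simp
      have : Real.log ((‖y‖ + r) / ‖x - y‖) ≤ Real.log (1 + 2 * r / ‖x‖) := by
        refine Real.log_le_log (by positivity) ?_
        rw [div_le_iff₀ hu']
        calc ‖y‖ + r ≤ ‖x‖ / 2 + r := by linarith
          _ = (1 + 2 * r / ‖x‖) * (‖x‖ / 2) := by field_simp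
          _ ≤ (1 + 2 * r / ‖x‖) * ‖x - y‖ := by gcongr
      linarith [neg_abs_le (Real.log (‖y‖ / ‖x - y‖))]
  calc ‖Real.log (1 + r / ‖y‖) * f y‖ = |Real.log (1 + r / ‖y‖)| * ‖f y‖ := by
        rw [norm_mul, Real.norm_eq_abs]
    _ ≤ (Real.log (1 + 2 * r / ‖x‖) + |Real.log (‖y‖ / ‖x - y‖)|) * ‖f y‖ := by gcongr
    _ = _ := by
        simp only [Pi.add_apply, norm_mul, Real.norm_eq_abs]
        ring

omit [InnerProductSpace ℝ E] [FiniteDimensional ℝ E] in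
lemma integrable_inv_max_mul_abs (hf : Integrable f μ) {m : ℝ} (hm : 0 < m) :
    Integrable (fun y => (max m ‖y‖)⁻¹ * |f y|) μ := by
  have hmeas : Measurable fun y : E => (max m ‖y‖)⁻¹ := by fun_prop
  refine hf.abs.bdd_mul (c := m⁻¹) hmeas.aestronglyMeasurable (.of_forall fun y => ?_)
  have := lt_max_of_lt_left (c := ‖y‖) hm
  rw [Real.norm_of_nonneg (by positivity)]
  gcongr
  exact le_max_left _ _

omit [InnerProductSpace ℝ E] [FiniteDimensional ℝ E] in
lemma tendsto_mul_integral_inv_max_mul_abs [NullSingletonClass μ] (hf : Integrable f μ) :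
    Filter.Tendsto (fun r : ℝ => r * ∫ y, (max (r / 2) ‖y‖)⁻¹ * |f y| ∂μ)
      (nhdsWithin 0 (Set.Ioi 0)) (nhds 0) := by
  simp_rw [← integral_const_mul]
  suffices h : Filter.Tendsto (fun r : ℝ => ∫ y, r * ((max (r / 2) ‖y‖)⁻¹ * |f y|) ∂μ)
      (nhdsWithin 0 (Set.Ioi 0)) (nhds (∫ _, 0 ∂μ)) by simpa using h
  refine tendsto_integral_filter_of_dominated_convergence (fun y => 2 * |f y|) ?_ ?_
    (hf.abs.const_mul 2) ?_
  · filter_upwards [self_mem_nhdsWithin] with r hr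
    exact ((integrable_inv_max_mul_abs hf (half_pos hr)).const_mul r).1
  · filter_upwards [self_mem_nhdsWithin] with r hr
    refine .of_forall fun y => ?_
    have hr' : (0 : ℝ) < r := hr
    have hm := lt_max_of_lt_left (c := ‖y‖) (half_pos hr')
    rw [Real.norm_of_nonneg (by positivity), ← mul_assoc]
    gcongr
    rw [← div_eq_mul_inv, div_le_iff₀ hm]
    linarith [le_max_left (r / 2) ‖y‖]
  · have h₀ : ∀ᵐ y ∂μ, y ≠ 0 := by simp [ae_iff]
    filter_upwards [h₀] with y hy
    have hc : ContinuousAt (fun r : ℝ => r * ((max (r / 2) ‖y‖)⁻¹ * |f y|)) 0 := by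
      have : max ((0 : ℝ) / 2) ‖y‖ ≠ 0 := (lt_max_of_lt_right (norm_pos_iff.2 hy)).ne'
      fun_prop (disch := assumption)
    simpa using hc.tendsto.mono_left nhdsWithin_le_nhds

variable [μ.IsAddHaarMeasure]

lemma ae_ne_zero_and_norm_ne [Nontrivial E] (r : ℝ) : ∀ᵐ y ∂μ, y ≠ 0 ∧ ‖y‖ ≠ r := by
  have h₀ : ∀ᵐ y ∂μ, y ≠ 0 := by simp [ae_iff]
  have h₁ : ∀ᵐ y ∂μ, ‖y‖ ≠ r := by
    have : {y : E | ¬‖y‖ ≠ r} = Metric.sphere 0 r := by ext; simp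
    rw [ae_iff, this, Measure.addHaar_sphere]
  exact h₀.and h₁

variable (h₁ : ‖e₁‖ = 1) (h₂ : ‖e₂‖ = 1) (h₁₂ : inner ℝ e₁ e₂ = 0)

include h₁ h₂ h₁₂

lemma integrable_prod_log_div_mul [Nontrivial E] (hf : Integrable f μ) {r : ℝ} (hr : 0 < r)
    (hint : Integrable (fun y => Real.log (1 + r / ‖y‖) * f y) μ) :
    Integrable (Function.uncurry fun (θ : ℝ) (y : E) =>
      Real.log (‖y‖ / ‖r • planeCircle e₁ e₂ θ - y‖) * f y)
      ((volume.restrict (Set.uIoc 0 (2 * Real.pi))).prod μ) := by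
  have hpi := Real.two_pi_pos
  have hm : Measurable fun z : ℝ × E =>
      Real.log (‖z.2‖ / ‖r • planeCircle e₁ e₂ z.1 - z.2‖) := by
    have := (continuous_planeCircle e₁ e₂).measurable
    fun_prop
  have hmeas : AEStronglyMeasurable (Function.uncurry fun (θ : ℝ) (y : E) =>
      Real.log (‖y‖ / ‖r • planeCircle e₁ e₂ θ - y‖) * f y)
      ((volume.restrict (Set.uIoc 0 (2 * Real.pi))).prod μ) :=
    hm.aestronglyMeasurable.mul hf.1.comp_snd
  refine (integrable_prod_iff' hmeas).2 ⟨?_, ?_⟩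
  · filter_upwards [ae_ne_zero_and_norm_ne (μ := μ) r] with y hy
    have := intervalIntegrable_log_div h₁ h₂ h₁₂ hr hy.1 hy.2
    exact (intervalIntegrable_iff.1 this).mul_const (f y)
  · refine (hint.norm.const_mul (4 * Real.pi)).mono' hmeas.norm.prod_swap.integral_prod_right' ?_
    filter_upwards [ae_ne_zero_and_norm_ne (μ := μ) r] with y hy
    have h := integral_abs_log_div_le h₁ h₂ h₁₂ hr hy.1 hy.2
    rw [intervalIntegral.integral_of_le hpi.le, ← Set.uIoc_of_le hpi.le] at h
    rw [Real.norm_of_nonneg (by positivity)]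
    simp only [Function.uncurry_apply_pair, norm_mul, integral_mul_const, Real.norm_eq_abs]
    rw [← mul_assoc]
    gcongr
    exact h.trans (by gcongr; exact le_abs_self _)

/-- Averaging the logarithmic potential of `f` over a circle of radius `r` replaces the distance
`‖x - y‖` by its geometric mean over the circle. -/
lemma integral_log_div_eq_of_forall_planeCircle [Nontrivial E] (hf : Integrable f μ) {r : ℝ}
    (hr : 0 < r) (hint : Integrable (fun y => Real.log (1 + r / ‖y‖) * f y) μ) {v : ℝ}
    (hv : ∀ θ, ∫ y, Real.log (‖y‖ / ‖r • planeCircle e₁ e₂ θ - y‖) * f y ∂μ = v) :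
    Integrable (fun y => (Real.log ‖y‖ - Real.log (circleMean e₁ e₂ r y)) * f y) μ ∧
      ∫ y, (Real.log ‖y‖ - Real.log (circleMean e₁ e₂ r y)) * f y ∂μ = v := by
  have hpi := Real.two_pi_pos
  have hprod := integrable_prod_log_div_mul h₁ h₂ h₁₂ hf hr hint
  have hinner : (fun y => ∫ θ in Set.uIoc 0 (2 * Real.pi),
      Real.log (‖y‖ / ‖r • planeCircle e₁ e₂ θ - y‖) * f y) =ᵐ[μ]
      fun y => 2 * Real.pi * ((Real.log ‖y‖ - Real.log (circleMean e₁ e₂ r y)) * f y) := by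
    filter_upwards [ae_ne_zero_and_norm_ne (μ := μ) r] with y hy
    have h := integral_log_div h₁ h₂ h₁₂ hr hy.1 hy.2
    rw [intervalIntegral.integral_of_le hpi.le, ← Set.uIoc_of_le hpi.le] at h
    rw [integral_mul_const, h, mul_assoc]
  constructor
  · have := (hprod.integral_prod_right.congr hinner).const_mul (2 * Real.pi)⁻¹
    simpa only [inv_mul_cancel_left₀ hpi.ne'] using this
  · have hswap := integral_integral_swap hprod
    simp_rw [hv] at hswap
    rw [integral_congr_ae hinner, integral_const_mul, setIntegral_const, Set.uIoc_of_le hpi.le,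
      Real.volume_real_Ioc_of_le hpi.le, sub_zero, smul_eq_mul] at hswap
    exact (mul_left_cancel₀ hpi.ne' hswap).symm

omit [FiniteDimensional ℝ E] [μ.IsAddHaarMeasure] in
lemma abs_integral_log_sub_le (hf : Integrable f μ) {r s m : ℝ} (hm : 0 < m) (hr : m ≤ r)
    (hs : m ≤ s)
    (hri : Integrable (fun y => (Real.log ‖y‖ - Real.log (circleMean e₁ e₂ r y)) * f y) μ)
    (hsi : Integrable (fun y => (Real.log ‖y‖ - Real.log (circleMean e₁ e₂ s y)) * f y) μ) :
    |∫ y, (Real.log ‖y‖ - Real.log (circleMean e₁ e₂ r y)) * f y ∂μ -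
      ∫ y, (Real.log ‖y‖ - Real.log (circleMean e₁ e₂ s y)) * f y ∂μ| ≤
      (∫ y, (max m ‖y‖)⁻¹ * |f y| ∂μ) * |r - s| := by
  rw [← integral_sub hri hsi, ← integral_mul_const, ← Real.norm_eq_abs]
  refine norm_integral_le_of_norm_le ((integrable_inv_max_mul_abs hf hm).mul_const _)
    (.of_forall fun y => ?_)
  have h := abs_log_sub_log_le (lt_max_of_lt_left hm)
    (max_le (hs.trans (le_circleMean e₁ e₂ s y)) (norm_le_circleMean h₁ h₂ h₁₂ s y))
    (max_le (hr.trans (le_circleMean e₁ e₂ r y)) (norm_le_circleMean h₁ h₂ h₁₂ r y))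
  have h' := abs_circleMean_sub_le e₁ e₂ s r y
  rw [← sub_mul, sub_sub_sub_cancel_left, norm_mul, Real.norm_eq_abs, Real.norm_eq_abs]
  calc _ ≤ |s - r| / max m ‖y‖ * |f y| := by
        gcongr
        exact h.trans (by gcongr)
    _ = _ := by
        rw [abs_sub_comm]
        ring

end LogPotential

/-- For integrable rotationally symmetric `f`, the radial derivative of the logarithmic
potential satisfies `r V'(r) → 0` as `r → 0`. -/
theorem stmt_7 {n : ℕ} (hn : Even n) (hn2 : 2 ≤ n)
    (f : EuclideanSpace ℝ (Fin n) → ℝ) (hf : Integrable f)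
    (hfrad : ∀ x y : EuclideanSpace ℝ (Fin n), ‖x‖ = ‖y‖ → f x = f y)
    (V V' : ℝ → ℝ)
    (hV : ∀ x : EuclideanSpace ℝ (Fin n),
      Cconst n * ∫ y, Real.log (‖y‖ / ‖x - y‖) * f y = V ‖x‖)
    (hV' : ∀ r > (0 : ℝ), HasDerivAt V (V' r) r) :
    Filter.Tendsto (fun r => r * V' r) (nhdsWithin 0 (Set.Ioi 0)) (nhds 0) := by
  by_cases hJ : Cconst n ≠ 0 ∧ ∃ x : EuclideanSpace ℝ (Fin n), x ≠ 0 ∧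
      Integrable fun y => Real.log (‖y‖ / ‖x - y‖) * f y
  swap
  · push Not at hJ
    have hV0 : ∀ r > 0, V r = 0 := by
      intro r hr
      have hx : ‖EuclideanSpace.single (⟨0, by omega⟩ : Fin n) r‖ = r := by
        rw [PiLp.norm_single, Real.norm_of_nonneg hr.le]
      rcases eq_or_ne (Cconst n) 0 with hc | hc
      · rw [← hx, ← hV, hc, zero_mul]
      · rw [← hx, ← hV, integral_undef, mul_zero]
        refine hJ hc _ (norm_pos_iff.1 ?_)
        rwa [hx]
    refine tendsto_const_nhds.congr' ?_
    filter_upwards [self_mem_nhdsWithin] with r hr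
    have h0 : HasDerivAt V 0 r := (hasDerivAt_const r (0 : ℝ)).congr_of_eventuallyEq
      ((eventually_gt_nhds hr).mono hV0)
    rw [(hV' r hr).unique h0, mul_zero]
  obtain ⟨hc, x, hx, hxi⟩ := hJ
  have : Nontrivial (EuclideanSpace ℝ (Fin n)) := ⟨x, 0, hx⟩
  obtain ⟨e₁, e₂, h₁, h₂, h₁₂⟩ : ∃ e₁ e₂ : EuclideanSpace ℝ (Fin n),
      ‖e₁‖ = 1 ∧ ‖e₂‖ = 1 ∧ inner ℝ e₁ e₂ = 0 :=
    ⟨EuclideanSpace.single ⟨0, by omega⟩ 1, EuclideanSpace.single ⟨1, by omega⟩ 1,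
      by simp, by simp, by simp [EuclideanSpace.inner_single_left]⟩
  have hC : ∀ r > 0,
      Integrable (fun y => (Real.log ‖y‖ - Real.log (circleMean e₁ e₂ r y)) * f y) ∧
      V r = Cconst n *
        ∫ y, (Real.log ‖y‖ - Real.log (circleMean e₁ e₂ r y)) * f y := by
    intro r hr
    have hnorm : ∀ θ, ‖r • planeCircle e₁ e₂ θ‖ = r := fun θ => by
      rw [norm_smul, norm_planeCircle h₁ h₂ h₁₂, Real.norm_of_nonneg hr.le, mul_one]
    have hint := integrable_log_one_add_div_mul hf hx hxi hr
    have h := integral_log_div_eq_of_forall_planeCircle h₁ h₂ h₁₂ hf hr hint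
      (v := V r / Cconst n) fun θ => by
        rw [eq_div_iff hc, mul_comm, hV, hnorm]
    exact ⟨h.1, by rw [h.2, mul_div_cancel₀ _ hc]⟩
  have hbound : ∀ r > 0, |V' r| ≤ |Cconst n| * ∫ y, (max (r / 2) ‖y‖)⁻¹ * |f y| := by
    intro r hr
    refine (hV' r hr).le_of_lip' (by positivity) ?_
    filter_upwards [eventually_gt_nhds (half_lt_self hr)] with s hs
    obtain ⟨hsi, hsV⟩ := hC s ((half_pos hr).trans hs)
    obtain ⟨hri, hrV⟩ := hC r hr
    rw [hsV, hrV, ← mul_sub, norm_mul, mul_assoc, Real.norm_eq_abs, Real.norm_eq_abs,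
      Real.norm_eq_abs]
    gcongr
    exact abs_integral_log_sub_le h₁ h₂ h₁₂ hf (half_pos hr) hs.le (half_le_self hr.le) hsi hri
  refine squeeze_zero_norm' (a := fun r : ℝ =>
    |Cconst n| * (r * ∫ y, (max (r / 2) ‖y‖)⁻¹ * |f y|)) ?_ ?_
  · filter_upwards [self_mem_nhdsWithin] with r hr
    have hr' : (0 : ℝ) < r := hr
    rw [norm_mul, Real.norm_of_nonneg hr'.le, Real.norm_eq_abs, mul_left_comm]
    gcongr
    exact hbound r hr
  · simpa using (tendsto_mul_integral_inv_max_mul_abs hf).const_mul |Cconst n|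
end

section
/- Let n be even and f ∈ L¹(ℝⁿ) rotationally symmetric, with v(x) = Cₙ ∫_{ℝⁿ} log(‖y‖/‖x−y‖) f(y) dy. Then there exists a constant C > 0 such that for all r > 0: r |V'(r)| ≤ C and r² |Δv(x)| ≤ C for ‖x‖ = r, where Δ is the Euclidean Laplacian. -/
open MeasureTheory

section Polar

variable {E : Type*} [NormedAddCommGroup E] [NormedSpace ℝ E] [MeasurableSpace E] [BorelSpace E]
  [FiniteDimensional ℝ E] [Nontrivial E] (μ : Measure E) [μ.IsAddHaarMeasure]

/-- Integrability in polar coordinates of a product of an angular and a radial function. -/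
theorem integrable_angular_mul_radial_iff (k : E → ℝ) (F : ℝ → ℝ) :
    Integrable (fun y : E => k (‖y‖⁻¹ • y) * F ‖y‖) μ ↔
      Integrable (fun z : Metric.sphere (0 : E) 1 × Set.Ioi (0 : ℝ) => k z.1 * F z.2)
        (μ.toSphere.prod (Measure.volumeIoiPow (Module.finrank ℝ E - 1))) := by
  rw [← μ.measurePreserving_homeomorphUnitSphereProd.integrable_comp_emb
    (Homeomorph.measurableEmbedding _)]
  conv_lhs => rw [← restrict_compl_singleton (μ := μ) 0]
  rw [← IntegrableOn, integrableOn_iff_comap_subtypeVal (by measurability)]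
  simp [Function.comp_def]

/-- If an angular function is integrable on the unit ball, then its product with any integrable
radial function is integrable. -/
theorem Integrable.angular_mul_radial (k : E → ℝ) (F : ℝ → ℝ)
    (hk : Integrable (fun y : E => k (‖y‖⁻¹ • y) * (Set.Iio (1 : ℝ)).indicator 1 ‖y‖) μ)
    (hF : Integrable (fun y : E => F ‖y‖) μ) :
    Integrable (fun y : E => k (‖y‖⁻¹ • y) * F ‖y‖) μ := by
  have hS : μ.toSphere ≠ 0 := μ.toSphere_ne_zero
  have hF' := (integrable_angular_mul_radial_iff μ (fun _ => 1) F).1 (by simpa using hF)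
  simp only [one_mul] at hF'
  have hF2 : Integrable (fun r : Set.Ioi (0 : ℝ) => F r)
      (Measure.volumeIoiPow (Module.finrank ℝ E - 1)) := by
    rwa [Integrable.comp_snd_iff (f := fun r : Set.Ioi (0 : ℝ) => F r) hS] at hF'
  have hk' := ((integrable_angular_mul_radial_iff μ k _).1 hk).prod_left_ae
  rw [integrable_angular_mul_radial_iff]
  refine Integrable.mul_prod (f := fun z : Metric.sphere (0 : E) 1 => k z) ?_ hF2
  have hpos : Measure.volumeIoiPow (Module.finrank ℝ E - 1)
      (Set.Iio (⟨1, Set.mem_Ioi.2 one_pos⟩ : Set.Ioi (0 : ℝ))) ≠ 0 := by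
    rw [Measure.volumeIoiPow_apply_Iio]
    simp
    positivity
  obtain ⟨r, hr, hrk⟩ := Filter.Frequently.exists
    ((frequently_ae_mem_iff.2 hpos).and_eventually hk')
  have : (r : ℝ) < 1 := hr
  simpa [this] using hrk

end Polar

/-- On `(-1, 1)`, negative powers above `-1` of the absolute value are integrable. -/
theorem integrable_indicator_abs_rpow {p : ℝ} (hp : -1 < p) :
    Integrable ((Metric.ball (0 : ℝ) 1).indicator fun t => |t| ^ p) := by
  rw [integrable_indicator_iff measurableSet_ball]
  refine (integrableOn_fun_norm_addHaar volume (f := fun t : ℝ => t ^ p)).2 ?_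
  simpa using (intervalIntegral.integrableOn_Ioo_rpow_iff one_pos).2 hp

theorem ae_forall_coord_ne_zero (n : ℕ) : ∀ᵐ y : EuclideanSpace ℝ (Fin n), ∀ j, y j ≠ 0 := by
  rw [ae_all_iff]
  intro j
  exact (EuclideanSpace.volume_preserving_symm_measurableEquiv_toLp
    (Fin n)).quasiMeasurePreserving.ae (Measure.ae_eval_ne (μ := fun _ => volume) j 0)

theorem abs_coord_lt_norm {n : ℕ} (i : Fin n) (hn : 2 ≤ n) {y : EuclideanSpace ℝ (Fin n)}
    (h0 : ∀ j, y j ≠ 0) : |y i| < ‖y‖ := by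
  have : Nontrivial (Fin n) := Fin.nontrivial_iff_two_le.2 hn
  obtain ⟨j, hj⟩ := exists_ne i
  have hpos : 0 < y j ^ 2 := by have := h0 j; positivity
  have hle : y j ^ 2 ≤ ∑ k ∈ Finset.univ.erase i, y k ^ 2 :=
    Finset.single_le_sum (f := fun k => y k ^ 2) (fun _ _ => sq_nonneg _)
      (Finset.mem_erase.2 ⟨hj, Finset.mem_univ j⟩)
  rw [← abs_of_nonneg (norm_nonneg y)]
  apply sq_lt_sq.1
  rw [EuclideanSpace.real_norm_sq_eq,
    ← Finset.add_sum_erase _ (fun k => y k ^ 2) (Finset.mem_univ i)]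
  linarith

theorem inv_one_sub_coord_le {n : ℕ} (i : Fin n) (hn : 2 ≤ n) (y : EuclideanSpace ℝ (Fin n))
    (hy : ‖y‖ < 1) (h0 : ∀ j, y j ≠ 0) :
    (1 - ‖y‖⁻¹ * y i)⁻¹ ≤ 2 * ∏ j ∈ Finset.univ.erase i, |y j| ^ (-(2 / ((n : ℝ) - 1))) := by
  have hn1 : (0 : ℝ) < (n : ℝ) - 1 := by
    have : (2 : ℝ) ≤ n := by exact_mod_cast hn
    linarith
  set Q : ℝ := ∑ j ∈ Finset.univ.erase i, y j ^ 2 with hQ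
  have hsq : ‖y‖ ^ 2 = y i ^ 2 + Q := by
    rw [EuclideanSpace.real_norm_sq_eq, hQ, Finset.add_sum_erase _ (fun j => y j ^ 2) (Finset.mem_univ i)]
  have hQj : ∀ j ∈ Finset.univ.erase i, |y j| ≤ Real.sqrt Q := fun j hj => by
    apply Real.abs_le_sqrt
    exact Finset.single_le_sum (f := fun j => y j ^ 2) (fun _ _ => sq_nonneg _) hj
  have hcard : (Finset.univ.erase i).card = n - 1 := by simp
  have hcast : ((n - 1 : ℕ) : ℝ) = n - 1 := by
    rw [Nat.cast_sub (by omega)]; simp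
  have hQpos : 0 < Q := by
    obtain ⟨j, hj⟩ : (Finset.univ.erase i).Nonempty := by
      rw [← Finset.card_pos, hcard]; omega
    have := (abs_pos.2 (h0 j)).trans_le (hQj j hj)
    exact Real.sqrt_pos.1 this
  have hprod : Q⁻¹ ≤ ∏ j ∈ Finset.univ.erase i, |y j| ^ (-(2 / ((n : ℝ) - 1))) := by
    have : Q⁻¹ = ∏ j ∈ Finset.univ.erase i, Real.sqrt Q ^ (-(2 / ((n : ℝ) - 1))) := by
      rw [Finset.prod_const, hcard, ← Real.rpow_natCast, ← Real.rpow_mul (Real.sqrt_nonneg _),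
        hcast, show -(2 / ((n : ℝ) - 1)) * (n - 1) = -(2 : ℕ) by field_simp; norm_num,
        Real.rpow_neg (Real.sqrt_nonneg _), Real.rpow_natCast, Real.sq_sqrt hQpos.le]
    rw [this]
    refine Finset.prod_le_prod (fun _ _ => by positivity) fun j hj => ?_
    exact Real.rpow_le_rpow_of_nonpos (abs_pos.2 (h0 j)) (hQj j hj)
      (by have : 0 < 2 / ((n : ℝ) - 1) := by positivity
          linarith)
  have hypos : 0 < ‖y‖ := (abs_pos.2 (h0 i)).trans_le (PiLp.norm_apply_le y i)
  refine le_trans ?_ (mul_le_mul_of_nonneg_left hprod two_pos.le)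
  obtain ⟨h1, h2⟩ := abs_lt.1 (abs_coord_lt_norm i hn h0)
  have hden : 1 - ‖y‖⁻¹ * y i = (‖y‖ - y i) / ‖y‖ := by field_simp
  rw [hden, inv_div, div_le_iff₀ (by linarith), mul_assoc, ← div_eq_inv_mul, mul_div_assoc',
    le_div_iff₀ hQpos]
  have : Q = (‖y‖ - y i) * (‖y‖ + y i) := by linear_combination -hsq
  rw [this]
  nlinarith [mul_pos (sub_pos.2 h2) hypos, mul_pos (sub_pos.2 h2) (sub_pos.2 hy),
    mul_nonneg (sub_pos.2 h2).le (sub_pos.2 h2).le]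

theorem integrable_inv_one_sub_coord {n : ℕ} (hn : 4 ≤ n) (i : Fin n) :
    Integrable fun y : EuclideanSpace ℝ (Fin n) =>
      (1 - ‖y‖⁻¹ * y i)⁻¹ * (Set.Iio (1 : ℝ)).indicator 1 ‖y‖ := by
  set p : ℝ := -(2 / ((n : ℝ) - 1)) with hp
  have hn4 : (4 : ℝ) ≤ n := by exact_mod_cast hn
  have hp1 : -1 < p := by
    rw [hp, neg_lt_neg_iff, div_lt_one] <;> linarith
  let φ : Fin n → ℝ → ℝ := fun j =>
    (Metric.ball (0 : ℝ) 1).indicator fun t => |t| ^ (if j = i then 0 else p)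
  have hφ : Integrable (fun x : Fin n → ℝ => ∏ j, φ j (x j)) :=
    Integrable.fintype_prod fun j => integrable_indicator_abs_rpow (by split_ifs <;> linarith)
  have hφ' := ((EuclideanSpace.volume_preserving_symm_measurableEquiv_toLp
    (Fin n)).integrable_comp_of_integrable hφ).const_mul 2
  refine hφ'.mono' (by
    refine Measurable.aestronglyMeasurable ?_
    refine Measurable.mul (by fun_prop) ?_
    exact (measurable_one.indicator measurableSet_Iio).comp measurable_norm) ?_
  filter_upwards [ae_forall_coord_ne_zero n] with y h0
  have hφ0 : ∀ j t, 0 ≤ φ j t := fun j t => Set.indicator_nonneg (fun _ _ => by positivity) _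
  by_cases hy : ‖y‖ < 1
  · have hyj : ∀ j, |y j| < 1 := fun j => (PiLp.norm_apply_le y j).trans_lt hy
    have hs : 0 ≤ 1 - ‖y‖⁻¹ * y i := by
      have := PiLp.norm_apply_le y i
      rw [sub_nonneg, inv_mul_eq_div]
      exact div_le_one_of_le₀ ((le_abs_self _).trans this) (norm_nonneg _)
    have hprod : ∏ j, φ j (y j) = ∏ j ∈ Finset.univ.erase i, |y j| ^ p := by
      rw [← Finset.mul_prod_erase _ _ (Finset.mem_univ i)]
      simp only [φ]
      rw [Set.indicator_of_mem (by simpa using hyj i), if_pos trivial, Real.rpow_zero, one_mul]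
      refine Finset.prod_congr rfl fun j hj => ?_
      rw [Set.indicator_of_mem (by simpa using hyj j), if_neg (Finset.ne_of_mem_erase hj)]
    simp only [Set.indicator_of_mem (Set.mem_Iio.2 hy), Pi.one_apply, mul_one, Real.norm_eq_abs]
    rw [abs_of_nonneg (inv_nonneg.2 hs)]
    refine (inv_one_sub_coord_le i (by omega) y hy h0).trans ?_
    simpa [Function.comp_def] using hprod.ge
  · simp only [Set.indicator_of_notMem (by simpa using hy : ‖y‖ ∉ Set.Iio (1 : ℝ)), mul_zero,
      norm_zero]
    exact mul_nonneg two_pos.le (Finset.prod_nonneg fun _ _ => hφ0 _ _)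

/-- The kernel `log (‖y‖ / ‖x - y‖)` as a function of `s = cos ∠(x, y)` and
`u = log (‖x‖ / ‖y‖)`. -/
noncomputable def logKernel (s u : ℝ) : ℝ :=
  -(u + Real.log 2 + Real.log (Real.cosh u - s)) / 2

/-- The first derivative of `logKernel` in `u`. -/
noncomputable def logKernel' (s u : ℝ) : ℝ :=
  -(1 + Real.sinh u / (Real.cosh u - s)) / 2

/-- The second derivative of `logKernel` in `u`. -/
noncomputable def logKernel'' (s u : ℝ) : ℝ :=
  -((Real.cosh u * (Real.cosh u - s) - Real.sinh u * Real.sinh u) / (Real.cosh u - s) ^ 2) / 2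

theorem cosh_sub_pos {s : ℝ} (hs : s < 1) (u : ℝ) : 0 < Real.cosh u - s := by
  linarith [Real.one_le_cosh u]

theorem hasDerivAt_logKernel {s : ℝ} (hs : s < 1) (u : ℝ) :
    HasDerivAt (logKernel s) (logKernel' s u) u :=
  ((((hasDerivAt_id u).add_const (Real.log 2)).add
    (((Real.hasDerivAt_cosh u).sub_const s).log (cosh_sub_pos hs u).ne')).neg).div_const 2

theorem hasDerivAt_logKernel' {s : ℝ} (hs : s < 1) (u : ℝ) :
    HasDerivAt (logKernel' s) (logKernel'' s u) u :=
  (((Real.hasDerivAt_sinh u).div ((Real.hasDerivAt_cosh u).sub_const s)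
    (cosh_sub_pos hs u).ne').const_add 1).neg.div_const 2

theorem abs_logKernel'_le {s : ℝ} (hs : s ∈ Set.Ico (-1) 1) (u : ℝ) :
    |logKernel' s u| ≤ 2 * (1 - s)⁻¹ := by
  have hc := cosh_sub_pos hs.2 u
  have h1 := Real.one_le_cosh u
  have hs1 : 0 < 1 - s := by linarith [hs.2]
  have hs2 : 0 ≤ 1 + s := by linarith [hs.1]
  have hsh : |Real.sinh u| ≤ Real.cosh u :=
    abs_le_of_sq_le_sq (by linarith [Real.cosh_sq u]) (by linarith)
  have h2 : |Real.sinh u / (Real.cosh u - s)| ≤ 2 * (1 - s)⁻¹ := by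
    rw [abs_div, abs_of_pos hc, ← div_eq_mul_inv, div_le_div_iff₀ hc hs1]
    nlinarith [mul_nonneg hs2 (sub_nonneg.2 h1), mul_le_mul_of_nonneg_right hsh hs1.le]
  have h3 : 1 ≤ 2 * (1 - s)⁻¹ := by
    rw [← div_eq_mul_inv, le_div_iff₀ hs1]
    linarith
  rw [logKernel', abs_div, abs_neg, abs_two]
  linarith [abs_add_le 1 (Real.sinh u / (Real.cosh u - s)), abs_one (α := ℝ)]

theorem abs_logKernel''_le {s : ℝ} (hs : s ∈ Set.Ico (-1) 1) (u : ℝ) :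
    |logKernel'' s u| ≤ 2 * (1 - s)⁻¹ := by
  have hc := cosh_sub_pos hs.2 u
  have h1 := Real.one_le_cosh u
  have hs1 : 0 < 1 - s := by linarith [hs.2]
  have hs2 : 0 ≤ 1 + s := by linarith [hs.1]
  have hnum : Real.cosh u * (Real.cosh u - s) - Real.sinh u * Real.sinh u
      = 1 - Real.cosh u * s := by linarith [Real.cosh_sq u]
  have h2 : |1 - Real.cosh u * s| ≤ (Real.cosh u + 1) * (Real.cosh u - s) := by
    rw [abs_le]
    constructor <;> nlinarith
  have h3 : (Real.cosh u + 1) * (1 - s) ≤ 2 * (Real.cosh u - s) := by nlinarith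
  have h4 : |(1 - Real.cosh u * s) / (Real.cosh u - s) ^ 2| ≤ 2 * (1 - s)⁻¹ := by
    rw [abs_div, abs_of_pos (pow_pos hc 2), ← div_eq_mul_inv, div_le_div_iff₀ (pow_pos hc 2) hs1]
    nlinarith [mul_le_mul_of_nonneg_right h2 hs1.le, mul_le_mul_of_nonneg_right h3 hc.le]
  rw [logKernel'', abs_div, abs_neg, abs_two, hnum]
  linarith [abs_nonneg ((1 - Real.cosh u * s) / (Real.cosh u - s) ^ 2)]

theorem log_norm_div_norm_sub {E : Type*} [NormedAddCommGroup E] [InnerProductSpace ℝ E]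
    {e y : E} (he : ‖e‖ = 1) (hy : y ≠ 0) (hs : inner ℝ e y / ‖y‖ < 1) (ρ : ℝ) :
    Real.log (‖y‖ / ‖Real.exp ρ • e - y‖) =
      logKernel (inner ℝ e y / ‖y‖) (ρ - Real.log ‖y‖) := by
  have hy0 : 0 < ‖y‖ := norm_pos_iff.2 hy
  have hρ := Real.exp_pos ρ
  set s := inner ℝ e y / ‖y‖ with hsdef
  have hc := cosh_sub_pos hs (ρ - Real.log ‖y‖)
  have hsq : ‖Real.exp ρ • e - y‖ ^ 2 =
      2 * Real.exp ρ * ‖y‖ * (Real.cosh (ρ - Real.log ‖y‖) - s) := by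
    rw [norm_sub_sq_real, norm_smul, inner_smul_left, he, Real.norm_eq_abs, Real.abs_exp,
      Real.cosh_eq, neg_sub, Real.exp_sub, Real.exp_sub, Real.exp_log hy0, hsdef]
    simp only [conj_trivial]
    field_simp
    ring
  have hpos : 0 < ‖Real.exp ρ • e - y‖ :=
    (norm_nonneg _).lt_of_ne fun h => by
      rw [← h] at hsq
      have : 0 < 2 * Real.exp ρ * ‖y‖ * (Real.cosh (ρ - Real.log ‖y‖) - s) := by positivity
      linarith
  have hlog : 2 * Real.log ‖Real.exp ρ • e - y‖ =
      Real.log 2 + ρ + Real.log ‖y‖ + Real.log (Real.cosh (ρ - Real.log ‖y‖) - s) := by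
    rw [← Real.log_exp ρ, ← Real.log_mul two_ne_zero hρ.ne', ← Real.log_mul (by positivity) hy0.ne',
      Real.log_exp ρ, ← Real.log_mul (by positivity) hc.ne', ← hsq, Real.log_pow]
    norm_num
  rw [Real.log_div hy0.ne' hpos.ne', logKernel]
  linarith

/-- A logarithmic potential, in logarithmic radial coordinates, has bounded first and second
derivatives. -/
theorem exists_bounded_derivs_integral_logKernel {α : Type*} [MeasurableSpace α] {μ : Measure α}
    {s τ f : α → ℝ} (hs : Measurable s) (hτ : Measurable τ) (hf : AEStronglyMeasurable f μ)
    (hs1 : ∀ᵐ a ∂μ, s a ∈ Set.Ico (-1) 1) (hint : Integrable (fun a => (1 - s a)⁻¹ * f a) μ) :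
    ∃ (W₁ W₂ : ℝ → ℝ) (A : ℝ), ∀ ρ,
      HasDerivAt (fun ρ => ∫ a, logKernel (s a) (ρ - τ a) * f a ∂μ) (W₁ ρ) ρ ∧
      HasDerivAt W₁ (W₂ ρ) ρ ∧ |W₁ ρ| ≤ A ∧ |W₂ ρ| ≤ A := by
  by_cases hex : ∃ ρ₀, Integrable (fun a => logKernel (s a) (ρ₀ - τ a) * f a) μ
  swap
  · refine ⟨0, 0, 0, fun ρ => ?_⟩
    have h0 : (fun ρ => ∫ a, logKernel (s a) (ρ - τ a) * f a ∂μ) = fun _ => 0 :=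
      funext fun ρ => integral_undef fun h => hex ⟨ρ, h⟩
    rw [h0]
    exact ⟨hasDerivAt_const _ _, hasDerivAt_const _ _, by simp, by simp⟩
  obtain ⟨ρ₀, hρ₀⟩ := hex
  set b : α → ℝ := fun a => 2 * ‖(1 - s a)⁻¹ * f a‖ with hb
  have hbi : Integrable b μ := hint.norm.const_mul 2
  have hm0 : ∀ ρ, AEStronglyMeasurable (fun a => logKernel (s a) (ρ - τ a) * f a) μ := fun ρ => by
    refine AEStronglyMeasurable.mul (Measurable.aestronglyMeasurable ?_) hf
    unfold logKernel; fun_prop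
  have hm1 : ∀ ρ, AEStronglyMeasurable (fun a => logKernel' (s a) (ρ - τ a) * f a) μ := fun ρ => by
    refine AEStronglyMeasurable.mul (Measurable.aestronglyMeasurable ?_) hf
    unfold logKernel'; fun_prop
  have hm2 : ∀ ρ, AEStronglyMeasurable (fun a => logKernel'' (s a) (ρ - τ a) * f a) μ := fun ρ => by
    refine AEStronglyMeasurable.mul (Measurable.aestronglyMeasurable ?_) hf
    unfold logKernel''; fun_prop
  have hbd : ∀ {a : α} {t : ℝ}, s a ∈ Set.Ico (-1) 1 → |t| ≤ 2 * (1 - s a)⁻¹ →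
      ‖t * f a‖ ≤ b a := fun {a t} ha ht => by
    have : 0 < 1 - s a := by linarith [ha.2]
    simp only [hb]
    rw [norm_mul, norm_mul, ← mul_assoc, Real.norm_eq_abs, Real.norm_eq_abs (1 - s a)⁻¹,
      abs_of_pos (inv_pos.2 this)]
    gcongr
  have hb1 : ∀ᵐ a ∂μ, ∀ ρ, ‖logKernel' (s a) (ρ - τ a) * f a‖ ≤ b a := by
    filter_upwards [hs1] with a ha ρ using hbd ha (abs_logKernel'_le ha _)
  have hb2 : ∀ᵐ a ∂μ, ∀ ρ, ‖logKernel'' (s a) (ρ - τ a) * f a‖ ≤ b a := by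
    filter_upwards [hs1] with a ha ρ using hbd ha (abs_logKernel''_le ha _)
  have hd1 : ∀ᵐ a ∂μ, ∀ ρ, HasDerivAt (fun ρ => logKernel (s a) (ρ - τ a) * f a)
      (logKernel' (s a) (ρ - τ a) * f a) ρ := by
    filter_upwards [hs1] with a ha ρ
    exact ((hasDerivAt_logKernel ha.2 _).comp_sub_const ρ (τ a)).mul_const _
  have hd2 : ∀ᵐ a ∂μ, ∀ ρ, HasDerivAt (fun ρ => logKernel' (s a) (ρ - τ a) * f a)
      (logKernel'' (s a) (ρ - τ a) * f a) ρ := by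
    filter_upwards [hs1] with a ha ρ
    exact ((hasDerivAt_logKernel' ha.2 _).comp_sub_const ρ (τ a)).mul_const _
  have hi0 : ∀ ρ, Integrable (fun a => logKernel (s a) (ρ - τ a) * f a) μ := fun ρ => by
    have hdiff : Integrable (fun a => logKernel (s a) (ρ - τ a) * f a -
        logKernel (s a) (ρ₀ - τ a) * f a) μ := by
      refine (hbi.mul_const |ρ - ρ₀|).mono' ((hm0 ρ).sub (hm0 ρ₀)) ?_
      filter_upwards [hd1, hb1] with a h1 h2
      exact convex_univ.norm_image_sub_le_of_norm_hasDerivWithin_le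
        (fun x _ => (h1 x).hasDerivWithinAt) (fun x _ => h2 x) (Set.mem_univ _) (Set.mem_univ _)
    refine (hdiff.add hρ₀).congr (.of_forall fun a => ?_)
    simp
  refine ⟨fun ρ => ∫ a, logKernel' (s a) (ρ - τ a) * f a ∂μ,
    fun ρ => ∫ a, logKernel'' (s a) (ρ - τ a) * f a ∂μ, ∫ a, b a ∂μ, fun ρ => ⟨?_, ?_, ?_, ?_⟩⟩
  · exact (hasDerivAt_integral_of_dominated_loc_of_deriv_le Filter.univ_mem
      (.of_forall hm0) (hi0 ρ) (hm1 ρ) (hb1.mono fun a h x _ => h x) hbi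
      (hd1.mono fun a h x _ => h x)).2
  · exact (hasDerivAt_integral_of_dominated_loc_of_deriv_le Filter.univ_mem
      (.of_forall hm1) (hbi.mono' (hm1 ρ) (hb1.mono fun a h => h ρ)) (hm2 ρ)
      (hb2.mono fun a h x _ => h x) hbi (hd2.mono fun a h x _ => h x)).2
  · exact norm_integral_le_of_norm_le hbi (hb1.mono fun a h => h ρ)
  · exact norm_integral_le_of_norm_le hbi (hb2.mono fun a h => h ρ)

theorem hasFDerivAt_log_norm {E : Type*} [NormedAddCommGroup E] [InnerProductSpace ℝ E]
    {x : E} (hx : x ≠ 0) :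
    HasFDerivAt (fun y : E => Real.log ‖y‖) ((‖x‖ ^ 2)⁻¹ • innerSL ℝ x) x := by
  have h := ((hasStrictFDerivAt_norm_sq x).hasFDerivAt.log
    (pow_ne_zero 2 (norm_ne_zero_iff.2 hx))).const_mul (1 / 2)
  refine (h.congr_of_eventuallyEq (.of_forall fun y => ?_)).congr_fderiv ?_
  · simp [Real.log_pow]
  · ext y
    simp
    ring

/-- The Laplacian of a radial function is controlled by its derivatives in the logarithmic
radial coordinate. -/
theorem norm_sq_mul_abs_lap_le {n : ℕ} {v : EuclideanSpace ℝ (Fin n) → ℝ} {W W₁ W₂ : ℝ → ℝ} {A : ℝ}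
    (hv : ∀ x ≠ 0, v x = W (Real.log ‖x‖)) (hW : ∀ ρ, HasDerivAt W (W₁ ρ) ρ)
    (hW₁ : ∀ ρ, HasDerivAt W₁ (W₂ ρ) ρ) (hA₁ : ∀ ρ, |W₁ ρ| ≤ A) (hA₂ : ∀ ρ, |W₂ ρ| ≤ A)
    {x : EuclideanSpace ℝ (Fin n)} (hx : x ≠ 0) :
    ‖x‖ ^ 2 * |lap v x| ≤ n * (4 * A) := by
  have hne : ∀ y : EuclideanSpace ℝ (Fin n), y ≠ 0 → ∀ᶠ z in nhds y, z ≠ 0 := fun y hy =>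
    isOpen_ne.mem_nhds hy
  have hfd : ∀ (i : Fin n) (y : EuclideanSpace ℝ (Fin n)), y ≠ 0 →
      fderiv ℝ v y (EuclideanSpace.single i 1) =
        W₁ (Real.log ‖y‖) * (y i * (‖y‖ ^ 2)⁻¹) := fun i y hy => by
    have h1 := ((hW (Real.log ‖y‖)).comp_hasFDerivAt y (hasFDerivAt_log_norm hy)).congr_of_eventuallyEq
      ((hne y hy).mono fun z hz => hv z hz)
    rw [h1.fderiv]
    simp [EuclideanSpace.inner_single_right, mul_comm (y i)]
  have hsecond : ∀ i : Fin n, fderiv ℝ (fun y => fderiv ℝ v y (EuclideanSpace.single i 1)) x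
      (EuclideanSpace.single i 1) =
        W₂ (Real.log ‖x‖) * (x i ^ 2 * (‖x‖ ^ 2)⁻¹ ^ 2) +
        W₁ (Real.log ‖x‖) * ((‖x‖ ^ 2)⁻¹ - 2 * x i ^ 2 * (‖x‖ ^ 2)⁻¹ ^ 2) := fun i => by
    have hsq := pow_ne_zero 2 (norm_ne_zero_iff.2 hx)
    have h1 := (hW₁ (Real.log ‖x‖)).comp_hasFDerivAt x (hasFDerivAt_log_norm hx)
    have h2 : HasFDerivAt (fun y : EuclideanSpace ℝ (Fin n) => y i)
        (EuclideanSpace.proj i : EuclideanSpace ℝ (Fin n) →L[ℝ] ℝ) x :=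
      (EuclideanSpace.proj i : EuclideanSpace ℝ (Fin n) →L[ℝ] ℝ).hasFDerivAt
    have h3 := (hasDerivAt_inv hsq).comp_hasFDerivAt x (hasStrictFDerivAt_norm_sq x).hasFDerivAt
    have h4 := (h1.mul (h2.mul h3)).congr_of_eventuallyEq
      ((hne x hx).mono fun z hz => hfd i z hz)
    rw [h4.fderiv]
    simp [EuclideanSpace.inner_single_right]
    ring
  have hterm : ∀ i : Fin n, ‖x‖ ^ 2 * |fderiv ℝ (fun y => fderiv ℝ v y (EuclideanSpace.single i 1)) x
      (EuclideanSpace.single i 1)| ≤ 4 * A := fun i => by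
    have hpos : 0 < ‖x‖ := norm_pos_iff.2 hx
    set t : ℝ := x i ^ 2 * (‖x‖ ^ 2)⁻¹ with ht
    have ht0 : 0 ≤ t := by positivity
    have ht1 : t ≤ 1 := by
      rw [ht, ← div_eq_mul_inv, div_le_one (by positivity)]
      exact sq_le_sq.2 (by simpa using PiLp.norm_apply_le x i)
    have heq : ‖x‖ ^ 2 * |fderiv ℝ (fun y => fderiv ℝ v y (EuclideanSpace.single i 1)) x
        (EuclideanSpace.single i 1)| =
        |W₂ (Real.log ‖x‖) * t + W₁ (Real.log ‖x‖) * (1 - 2 * t)| := by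
      rw [hsecond i, ← abs_of_nonneg (sq_nonneg ‖x‖), ← abs_mul, abs_of_nonneg (sq_nonneg ‖x‖), ht]
      congr 1
      field_simp
    rw [heq]
    have hA0 := (abs_nonneg _).trans (hA₁ 0)
    have h5 : |W₂ (Real.log ‖x‖) * t| ≤ A * 1 := by
      rw [abs_mul]
      exact mul_le_mul (hA₂ _) (by rwa [abs_of_nonneg ht0]) (abs_nonneg _) hA0
    have h6 : |W₁ (Real.log ‖x‖) * (1 - 2 * t)| ≤ A * 1 := by
      rw [abs_mul]
      exact mul_le_mul (hA₁ _) (abs_le.2 ⟨by linarith, by linarith⟩) (abs_nonneg _) hA0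
    linarith [abs_add_le (W₂ (Real.log ‖x‖) * t) (W₁ (Real.log ‖x‖) * (1 - 2 * t))]
  calc ‖x‖ ^ 2 * |lap v x| ≤ ‖x‖ ^ 2 * ∑ i, |fderiv ℝ (fun y => fderiv ℝ v y
        (EuclideanSpace.single i 1)) x (EuclideanSpace.single i 1)| := by
        gcongr
        exact Finset.abs_sum_le_sum_abs _ _
    _ ≤ ∑ _i : Fin n, 4 * A := by
        rw [Finset.mul_sum]
        exact Finset.sum_le_sum fun i _ => hterm i
    _ = n * (4 * A) := by simp

/-- Uniform bounds `r|V'(r)| ≤ C` and `r²|Δv| ≤ C` for the logarithmic potential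
of an integrable rotationally symmetric function. -/
theorem stmt_8 {m n : ℕ} (hm : 2 ≤ m) (hn : n = 2 * m)
    (f : EuclideanSpace ℝ (Fin n) → ℝ) (hf : Integrable f)
    (hfrad : ∀ x y : EuclideanSpace ℝ (Fin n), ‖x‖ = ‖y‖ → f x = f y)
    (v : EuclideanSpace ℝ (Fin n) → ℝ)
    (hv : ∀ x, v x = Cconst n * ∫ y, Real.log (‖y‖ / ‖x - y‖) * f y)
    (V V' : ℝ → ℝ)
    (hV : ∀ x : EuclideanSpace ℝ (Fin n), v x = V ‖x‖)
    (hV' : ∀ r > (0 : ℝ), HasDerivAt V (V' r) r) :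
    ∃ C > (0 : ℝ), ∀ r > (0 : ℝ),
      r * |V' r| ≤ C ∧
      ∀ x : EuclideanSpace ℝ (Fin n), ‖x‖ = r → r ^ 2 * |lap v x| ≤ C := by
  have hn4 : 4 ≤ n := by omega
  let i : Fin n := ⟨0, by omega⟩
  set e : EuclideanSpace ℝ (Fin n) := EuclideanSpace.single i 1 with he
  have he1 : ‖e‖ = 1 := by simp [he]
  have hinner : ∀ y : EuclideanSpace ℝ (Fin n), inner ℝ e y = y i := fun y => by simp [he, EuclideanSpace.inner_single_left]
  let s : EuclideanSpace ℝ (Fin n) → ℝ := fun y => inner ℝ e y / ‖y‖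
  have hs : Measurable s := by fun_prop
  have hs1 : ∀ᵐ y, s y ∈ Set.Ico (-1) 1 := by
    filter_upwards [ae_forall_coord_ne_zero n] with y hy
    have hlt := abs_coord_lt_norm i (by omega) hy
    have hpos := (abs_nonneg _).trans_lt hlt
    obtain ⟨h1, h2⟩ := abs_lt.1 hlt
    simp only [s, hinner]
    exact ⟨by rw [le_div_iff₀ hpos]; linarith, by rw [div_lt_one hpos]; exact h2⟩
  have hF : ∀ y, f (EuclideanSpace.single i ‖y‖) = f y := fun y => hfrad _ _ (by simp)
  have : Nontrivial (EuclideanSpace ℝ (Fin n)) :=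
    ⟨e, 0, fun h => one_ne_zero (he1.symm.trans (by rw [h, norm_zero]))⟩
  have hint : Integrable fun y => (1 - s y)⁻¹ * f y := by
    have := Integrable.angular_mul_radial volume (fun y : EuclideanSpace ℝ (Fin n) => (1 - y i)⁻¹)
      (fun r => f (EuclideanSpace.single i r))
      (by simpa using integrable_inv_one_sub_coord hn4 i) (by simpa only [hF] using hf)
    simpa [hF, s, hinner, div_eq_inv_mul] using this
  obtain ⟨W₁, W₂, A, hW⟩ := exists_bounded_derivs_integral_logKernel hs
    (τ := fun y => Real.log ‖y‖) (by fun_prop) hf.aestronglyMeasurable hs1 hint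
  set W : ℝ → ℝ := fun ρ => ∫ y, logKernel (s y) (ρ - Real.log ‖y‖) * f y with hWdef
  set c := Cconst n
  have hVW : ∀ r > 0, V r = c * W (Real.log r) := fun r hr => by
    have hr' : ‖r • e‖ = r := by rw [norm_smul, he1, mul_one, Real.norm_of_nonneg hr.le]
    rw [← hr', ← hV, hr', hv, hWdef]
    congr 1
    refine integral_congr_ae ?_
    filter_upwards [hs1, ae_forall_coord_ne_zero n] with y hy hy0
    have hyne : y ≠ 0 := fun h => hy0 i (by simp [h])
    rw [← log_norm_div_norm_sub he1 hyne hy.2, Real.exp_log hr]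
  have hd : ∀ ρ, HasDerivAt (fun ρ => c * W ρ) (c * W₁ ρ) ρ := fun ρ => (hW ρ).1.const_mul c
  have hA1 : ∀ ρ, |c * W₁ ρ| ≤ |c| * A := fun ρ => by
    rw [abs_mul]
    exact mul_le_mul_of_nonneg_left (hW ρ).2.2.1 (abs_nonneg c)
  have hA2 : ∀ ρ, |c * W₂ ρ| ≤ |c| * A := fun ρ => by
    rw [abs_mul]
    exact mul_le_mul_of_nonneg_left (hW ρ).2.2.2 (abs_nonneg c)
  have hA0 : 0 ≤ |c| * A := (abs_nonneg _).trans (hA1 0)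
  have hnA : 0 ≤ n * (4 * (|c| * A)) := by positivity
  refine ⟨|c| * A + n * (4 * (|c| * A)) + 1, by linarith, fun r hr => ⟨?_, ?_⟩⟩
  · have h1 : HasDerivAt V (c * W₁ (Real.log r) * r⁻¹) r :=
      ((hd (Real.log r)).comp r (Real.hasDerivAt_log hr.ne')).congr_of_eventuallyEq
        ((eventually_gt_nhds hr).mono hVW)
    rw [(hV' r hr).unique h1, abs_mul, abs_of_pos (inv_pos.2 hr), mul_comm, mul_assoc,
      inv_mul_cancel₀ hr.ne', mul_one]
    linarith [hA1 (Real.log r)]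
  · rintro x rfl
    have := norm_sq_mul_abs_lap_le (fun y hy => (hV y).trans (hVW _ (norm_pos_iff.2 hy))) hd
      (fun ρ => (hW ρ).2.1.const_mul c) hA1 hA2 (norm_pos_iff.1 hr)
    linarith
end

section
/- Let n = 2m be even and let w be smooth on ℝⁿ satisfying Δw + (m−1)‖∇w‖² ≤ 0 pointwise (i.e., the metric e^{2w}g₀ has nonnegative scalar curvature). Then the spherical average w̄(r) = ⨍_{S^{n−1}} w(r,θ) dθ also satisfies Δw̄ + (m−1)‖∇w̄‖² ≤ 0 away from the origin. -/
open MeasureTheory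

open Metric Topology InnerProductSpace
open scoped Pointwise

section ParametricIntegral

variable {X E F : Type*} [TopologicalSpace X] [CompactSpace X] [MeasurableSpace X]
  [OpensMeasurableSpace X] [NormedAddCommGroup F] {μ : Measure X} [IsFiniteMeasure μ]

theorem Continuous.integrable_of_compactSpace [SecondCountableTopologyEither X F]
    {f : X → F} (hf : Continuous f) : Integrable f μ := by
  obtain ⟨C, hC⟩ := isCompact_univ.exists_bound_of_continuousOn hf.continuousOn
  exact Integrable.of_bound hf.aestronglyMeasurable C (.of_forall fun a => hC a (Set.mem_univ a))

/-- Differentiation under the integral sign over a compact parameter space. -/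
theorem hasFDerivAt_integral_of_compactSpace [SecondCountableTopology X]
    [NormedAddCommGroup E] [NormedSpace ℝ E] [ProperSpace E] [NormedSpace ℝ F]
    {f : E → X → F} {f' : E → X → E →L[ℝ] F} (hf : Continuous (Function.uncurry f))
    (hf' : Continuous (Function.uncurry f'))
    (hderiv : ∀ x a, HasFDerivAt (f · a) (f' x a) x) (x₀ : E) :
    HasFDerivAt (fun x => ∫ a, f x a ∂μ) (∫ a, f' x₀ a ∂μ) x₀ := by
  obtain ⟨C, hC⟩ := ((isCompact_closedBall x₀ 1).prod
    (isCompact_univ (X := X))).exists_bound_of_continuousOn hf'.continuousOn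
  have hcont (x : E) : Continuous (f x) := hf.comp (by fun_prop : Continuous fun a => (x, a))
  have hcont' : Continuous (f' x₀) := hf'.comp (by fun_prop : Continuous fun a => (x₀, a))
  refine hasFDerivAt_integral_of_dominated_of_fderiv_le (bound := fun _ => C)
    (closedBall_mem_nhds x₀ one_pos) (.of_forall fun x => (hcont x).aestronglyMeasurable)
    (hcont x₀).integrable_of_compactSpace hcont'.aestronglyMeasurable
    (.of_forall fun a x hx => hC (x, a) ⟨hx, Set.mem_univ a⟩) (integrable_const C)
    (.of_forall fun a x _ => hderiv x a)

end ParametricIntegral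

section OrthogonalAverage

variable {E : Type*} [NormedAddCommGroup E] [InnerProductSpace ℝ E] [FiniteDimensional ℝ E]

instance : CompactSpace (unitary (E →L[ℝ] E)) := by
  have : ProperSpace (E →L[ℝ] E) := FiniteDimensional.proper ℝ _
  refine isCompact_iff_compactSpace.mp (Metric.isCompact_of_isClosed_isBounded isClosed_unitary ?_)
  refine (Metric.isBounded_closedBall (x := (0 : E →L[ℝ] E)) (r := 1)).subset fun A hA => ?_
  rw [mem_closedBall_zero_iff]
  exact A.opNorm_le_bound zero_le_one fun x => by
    rw [ContinuousLinearMap.norm_map_of_mem_unitary hA, one_mul]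

instance : SecondCountableTopology (unitary (E →L[ℝ] E)) := by
  have : ProperSpace (E →L[ℝ] E) := FiniteDimensional.proper ℝ _
  exact TopologicalSpace.Subtype.secondCountableTopology _

/-- The orthogonal group acts transitively on spheres centered at the origin. -/
theorem exists_unitary_apply_eq {x y : E} (h : ‖x‖ = ‖y‖) :
    ∃ A : unitary (E →L[ℝ] E), (A : E →L[ℝ] E) x = y :=
  ⟨Unitary.linearIsometryEquiv.symm (Submodule.reflection (Submodule.span ℝ {x - y})ᗮ),
    Submodule.reflection_sub h⟩

instance : BorelSpace (unitary (E →L[ℝ] E)) := Subtype.borelSpace _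

theorem exists_isProbabilityMeasure_isMulRightInvariant_unitary :
    ∃ μ : Measure (unitary (E →L[ℝ] E)), IsProbabilityMeasure μ ∧ μ.IsMulRightInvariant := by
  let μ : Measure (unitary (E →L[ℝ] E)) := Measure.haarMeasure ⊤
  have : IsProbabilityMeasure μ := ⟨Measure.haarMeasure_self⟩
  exact ⟨μ.inv, ⟨by simp⟩, inferInstance⟩

variable (μ : Measure (unitary (E →L[ℝ] E)))

/-- The average of a function over the orthogonal group with respect to `μ`. -/
noncomputable def orthAvg (w : E → ℝ) (x : E) : ℝ :=
  ∫ A : unitary (E →L[ℝ] E), w ((A : E →L[ℝ] E) x) ∂μ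

theorem orthAvg_eq_of_norm_eq [μ.IsMulRightInvariant] (w : E → ℝ) {x y : E} (h : ‖x‖ = ‖y‖) :
    orthAvg μ w x = orthAvg μ w y := by
  obtain ⟨B, rfl⟩ := exists_unitary_apply_eq h
  exact (integral_mul_right_eq_self (fun A : unitary (E →L[ℝ] E) => w ((A : E →L[ℝ] E) x)) B).symm

section Smooth

variable [IsFiniteMeasure μ] {w : E → ℝ}

theorem hasFDerivAt_orthAvg (hw : ContDiff ℝ 1 w) (x : E) :
    HasFDerivAt (orthAvg μ w)
      (∫ A : unitary (E →L[ℝ] E), (fderiv ℝ w ((A : E →L[ℝ] E) x)).comp (A : E →L[ℝ] E) ∂μ) x := by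
  have h' : Continuous (fderiv ℝ w) := hw.continuous_fderiv one_ne_zero
  have h := hw.continuous
  refine hasFDerivAt_integral_of_compactSpace
    (f := fun x (A : unitary (E →L[ℝ] E)) => w ((A : E →L[ℝ] E) x))
    (f' := fun x (A : unitary (E →L[ℝ] E)) =>
      (fderiv ℝ w ((A : E →L[ℝ] E) x)).comp (A : E →L[ℝ] E)) ?_ ?_ ?_ x
  · simp only [Function.uncurry_def]; fun_prop
  · simp only [Function.uncurry_def]; fun_prop
  · exact fun x A => ((hw.differentiable one_ne_zero).differentiableAt.hasFDerivAt).comp x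
      (A : E →L[ℝ] E).hasFDerivAt

theorem hasFDerivAt_fderiv_orthAvg (hw : ContDiff ℝ 2 w) (x : E) :
    HasFDerivAt (fderiv ℝ (orthAvg μ w))
      (∫ A : unitary (E →L[ℝ] E), ((ContinuousLinearMap.compL ℝ E E ℝ).flip (A : E →L[ℝ] E)).comp
        ((fderiv ℝ (fderiv ℝ w) ((A : E →L[ℝ] E) x)).comp (A : E →L[ℝ] E)) ∂μ) x := by
  have h1 : ContDiff ℝ 1 (fderiv ℝ w) := hw.fderiv_right (by norm_num)
  have h'' : Continuous (fderiv ℝ (fderiv ℝ w)) := h1.continuous_fderiv one_ne_zero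
  have h' := h1.continuous
  rw [funext fun y => (hasFDerivAt_orthAvg μ (hw.of_le (by norm_num)) y).fderiv]
  refine hasFDerivAt_integral_of_compactSpace
    (f := fun x (A : unitary (E →L[ℝ] E)) =>
      (fderiv ℝ w ((A : E →L[ℝ] E) x)).comp (A : E →L[ℝ] E))
    (f' := fun x (A : unitary (E →L[ℝ] E)) =>
      ((ContinuousLinearMap.compL ℝ E E ℝ).flip (A : E →L[ℝ] E)).comp
        ((fderiv ℝ (fderiv ℝ w) ((A : E →L[ℝ] E) x)).comp (A : E →L[ℝ] E))) ?_ ?_ ?_ x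
  · simp only [Function.uncurry_def]; fun_prop
  · simp only [Function.uncurry_def]; fun_prop
  · exact fun x A => ((ContinuousLinearMap.compL ℝ E E ℝ).flip (A : E →L[ℝ] E)).hasFDerivAt.comp x
      (((h1.differentiable one_ne_zero).differentiableAt.hasFDerivAt).comp x
        (A : E →L[ℝ] E).hasFDerivAt)

theorem laplacian_eq_sum_fderiv_fderiv {ι : Type*} [Fintype ι] (f : E → ℝ)
    (v : OrthonormalBasis ι ℝ E) (x : E) :
    Laplacian.laplacian f x = ∑ i, fderiv ℝ (fderiv ℝ f) x (v i) (v i) := by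
  simp [laplacian_eq_iteratedFDeriv_orthonormalBasis f v, iteratedFDeriv_two_apply]

theorem continuous_laplacian (hw : ContDiff ℝ 2 w) : Continuous (Laplacian.laplacian w) := by
  have h1 : ContDiff ℝ 1 (fderiv ℝ w) := hw.fderiv_right (by norm_num)
  have h2 : Continuous (fderiv ℝ (fderiv ℝ w)) := h1.continuous_fderiv one_ne_zero
  rw [funext (laplacian_eq_sum_fderiv_fderiv w (stdOrthonormalBasis ℝ E))]
  fun_prop

/-- Averaging over the orthogonal group commutes with the Laplacian. -/
theorem laplacian_orthAvg (hw : ContDiff ℝ 2 w) :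
    Laplacian.laplacian (orthAvg μ w) = orthAvg μ (Laplacian.laplacian w) := by
  ext x
  let b := stdOrthonormalBasis ℝ E
  have h1 : ContDiff ℝ 1 (fderiv ℝ w) := hw.fderiv_right (by norm_num)
  have h2 : Continuous (fderiv ℝ (fderiv ℝ w)) := h1.continuous_fderiv one_ne_zero
  have key (A : unitary (E →L[ℝ] E)) : Laplacian.laplacian w ((A : E →L[ℝ] E) x) =
      ∑ i, fderiv ℝ (fderiv ℝ w) ((A : E →L[ℝ] E) x) ((A : E →L[ℝ] E) (b i))
        ((A : E →L[ℝ] E) (b i)) := by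
    rw [laplacian_eq_sum_fderiv_fderiv w (b.map (Unitary.linearIsometryEquiv A))]
    rfl
  rw [laplacian_eq_sum_fderiv_fderiv _ b, (hasFDerivAt_fderiv_orthAvg μ hw x).fderiv, orthAvg]
  simp_rw [key]
  rw [integral_finsetSum _ fun i _ => Continuous.integrable_of_compactSpace (by fun_prop)]
  refine Finset.sum_congr rfl fun i _ => ?_
  rw [ContinuousLinearMap.integral_apply (Continuous.integrable_of_compactSpace (by fun_prop)),
    ContinuousLinearMap.integral_apply (Continuous.integrable_of_compactSpace (by fun_prop))]
  rfl

end Smooth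

theorem sq_integral_le {Ω : Type*} [MeasurableSpace Ω] {P : Measure Ω} [IsProbabilityMeasure P]
    {f : Ω → ℝ} (hf : Integrable f P) (hf2 : Integrable (fun a => f a ^ 2) P) :
    (∫ a, f a ∂P) ^ 2 ≤ ∫ a, f a ^ 2 ∂P :=
  (even_two.convexOn_pow (𝕜 := ℝ)).map_integral_le
    (by fun_prop) isClosed_univ (by simp) hf hf2

theorem sq_norm_fderiv_orthAvg_le [IsProbabilityMeasure μ] {w : E → ℝ} (hw : ContDiff ℝ 1 w)
    (x : E) :
    ‖fderiv ℝ (orthAvg μ w) x‖ ^ 2 ≤ orthAvg μ (fun y => ‖fderiv ℝ w y‖ ^ 2) x := by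
  have h' : Continuous (fderiv ℝ w) := hw.continuous_fderiv one_ne_zero
  have hle : ‖fderiv ℝ (orthAvg μ w) x‖ ≤
      ∫ A : unitary (E →L[ℝ] E), ‖fderiv ℝ w ((A : E →L[ℝ] E) x)‖ ∂μ := by
    rw [(hasFDerivAt_orthAvg μ hw x).fderiv]
    refine norm_integral_le_of_norm_le (Continuous.integrable_of_compactSpace (by fun_prop))
      (.of_forall fun A => ?_)
    exact ((fderiv ℝ w ((A : E →L[ℝ] E) x)).opNorm_comp_le _).trans <|
      mul_le_of_le_one_right (norm_nonneg _) <|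
        ContinuousLinearMap.opNorm_le_bound _ zero_le_one fun y => by
          rw [Unitary.norm_map, one_mul]
  exact (pow_le_pow_left₀ (norm_nonneg _) hle 2).trans <|
    sq_integral_le (Continuous.integrable_of_compactSpace (by fun_prop))
      (Continuous.integrable_of_compactSpace (by fun_prop))

/-- A differential inequality `Δw + c‖∇w‖² ≤ 0` with `c ≥ 0` is preserved by averaging over the
orthogonal group. -/
theorem laplacian_orthAvg_add_le [IsProbabilityMeasure μ] {w : E → ℝ} (hw : ContDiff ℝ 2 w)
    {c : ℝ} (hc : 0 ≤ c) (h : ∀ x, Laplacian.laplacian w x + c * ‖fderiv ℝ w x‖ ^ 2 ≤ 0) (x : E) :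
    Laplacian.laplacian (orthAvg μ w) x + c * ‖fderiv ℝ (orthAvg μ w) x‖ ^ 2 ≤ 0 := by
  have hw1 : ContDiff ℝ 1 w := hw.of_le (by norm_num)
  have h' : Continuous (fderiv ℝ w) := hw1.continuous_fderiv one_ne_zero
  have hΔ := continuous_laplacian hw
  calc _ ≤ orthAvg μ (Laplacian.laplacian w) x + c * orthAvg μ (fun y => ‖fderiv ℝ w y‖ ^ 2) x := by
        rw [laplacian_orthAvg μ hw]
        gcongr
        exact sq_norm_fderiv_orthAvg_le μ hw1 x
    _ = orthAvg μ (fun y => Laplacian.laplacian w y + c * ‖fderiv ℝ w y‖ ^ 2) x := by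
        simp only [orthAvg]
        rw [integral_add (Continuous.integrable_of_compactSpace (by fun_prop))
          (Continuous.integrable_of_compactSpace (by fun_prop)), integral_const_mul]
    _ ≤ 0 := integral_nonpos fun A => h _

/-- Integrating over an orthogonally invariant probability measure on a sphere is the same as
averaging over the orthogonal group. -/
theorem integral_eq_orthAvg [MeasurableSpace E] [BorelSpace E] [IsProbabilityMeasure μ]
    [μ.IsMulRightInvariant] {ν : Measure E} [IsProbabilityMeasure ν]
    (hν : ∀ A : E ≃ₗᵢ[ℝ] E, MeasurePreserving A ν ν) {w : E → ℝ} (hw : Continuous w) {y : E}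
    (hsupp : ∀ᵐ z ∂ν, ‖z‖ = ‖y‖) : ∫ z, w z ∂ν = orthAvg μ w y := by
  obtain ⟨C, hC⟩ := (isCompact_closedBall (0 : E) ‖y‖).exists_bound_of_continuousOn hw.continuousOn
  have hcont : Continuous fun p : unitary (E →L[ℝ] E) × E => w ((p.1 : E →L[ℝ] E) p.2) := by
    fun_prop
  have hint : Integrable (fun p : unitary (E →L[ℝ] E) × E => w ((p.1 : E →L[ℝ] E) p.2))
      (μ.prod ν) := by
    refine Integrable.of_bound hcont.aestronglyMeasurable C ?_
    filter_upwards [Measure.quasiMeasurePreserving_snd.ae hsupp] with p hp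
    exact hC _ (by simp [Unitary.norm_map, hp])
  calc ∫ z, w z ∂ν = ∫ A : unitary (E →L[ℝ] E), ∫ z, w ((A : E →L[ℝ] E) z) ∂ν ∂μ := by
        have (A : unitary (E →L[ℝ] E)) : ∫ z, w ((A : E →L[ℝ] E) z) ∂ν = ∫ z, w z ∂ν :=
          (hν (Unitary.linearIsometryEquiv A)).integral_comp
            (Unitary.linearIsometryEquiv A).toHomeomorph.measurableEmbedding w
        simp [this]
    _ = ∫ z, orthAvg μ w z ∂ν := integral_integral_swap hint
    _ = ∫ _z, orthAvg μ w y ∂ν := integral_congr_ae <| by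
        filter_upwards [hsupp] with z hz using orthAvg_eq_of_norm_eq μ w hz
    _ = orthAvg μ w y := by simp

end OrthogonalAverage

section Sphere

variable {n : ℕ}

theorem hausdorffMeasure_sphere (hn : 1 ≤ n) {r : ℝ} (hr : 0 < r) :
    μH[(n : ℝ) - 1] (sphere (0 : EuclideanSpace ℝ (Fin n)) r) =
      ‖r‖₊ ^ ((n : ℝ) - 1) • μH[(n : ℝ) - 1] (sphere (0 : EuclideanSpace ℝ (Fin n)) 1) := by
  have hd : (0 : ℝ) ≤ (n : ℝ) - 1 := by simpa using hn
  rw [← Measure.hausdorffMeasure_smul₀ hd hr.ne', smul_sphere' hr.ne']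
  simp [abs_of_pos hr]

theorem sphereAvg_eq_zero (hn : 1 ≤ n)
    (h : μH[(n : ℝ) - 1] (sphere (0 : EuclideanSpace ℝ (Fin n)) 1) = 0 ∨
      μH[(n : ℝ) - 1] (sphere (0 : EuclideanSpace ℝ (Fin n)) 1) = ⊤)
    {r : ℝ} (hr : 0 < r) (w : EuclideanSpace ℝ (Fin n) → ℝ) : sphereAvg 0 r w = 0 := by
  have hr' : ‖r‖₊ ^ ((n : ℝ) - 1) ≠ 0 := (NNReal.rpow_pos (by simpa using hr.ne')).ne'
  rw [sphereAvg, setAverage_eq, measureReal_def, hausdorffMeasure_sphere hn hr]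
  rcases h with h | h <;> simp [h, ENNReal.smul_top, hr']

theorem sphereAvg_eq_orthAvg (hn : 1 ≤ n)
    (h0 : μH[(n : ℝ) - 1] (sphere (0 : EuclideanSpace ℝ (Fin n)) 1) ≠ 0)
    (htop : μH[(n : ℝ) - 1] (sphere (0 : EuclideanSpace ℝ (Fin n)) 1) ≠ ⊤)
    (μ : Measure (unitary (EuclideanSpace ℝ (Fin n) →L[ℝ] EuclideanSpace ℝ (Fin n))))
    [IsProbabilityMeasure μ] [μ.IsMulRightInvariant]
    {w : EuclideanSpace ℝ (Fin n) → ℝ} (hw : Continuous w)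
    {y : EuclideanSpace ℝ (Fin n)} (hy : y ≠ 0) : sphereAvg 0 ‖y‖ w = orthAvg μ w y := by
  have hpos : 0 < ‖y‖ := norm_pos_iff.mpr hy
  set S := sphere (0 : EuclideanSpace ℝ (Fin n)) ‖y‖
  let ρ : Measure (EuclideanSpace ℝ (Fin n)) := μH[(n : ℝ) - 1].restrict S
  have hr : ‖‖y‖‖₊ ^ ((n : ℝ) - 1) ≠ 0 := (NNReal.rpow_pos (by simpa using hy)).ne'
  have hS : ρ Set.univ = ‖‖y‖‖₊ ^ ((n : ℝ) - 1) •
      μH[(n : ℝ) - 1] (sphere (0 : EuclideanSpace ℝ (Fin n)) 1) := by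
    rw [Measure.restrict_apply_univ, hausdorffMeasure_sphere hn hpos]
  have : NeZero ρ := ⟨fun h => by
    rw [h, ENNReal.smul_def, smul_eq_mul] at hS
    exact mul_ne_zero (by exact_mod_cast hr) h0 hS.symm⟩
  have : IsFiniteMeasure ρ := ⟨by
    rw [hS, ENNReal.smul_def, smul_eq_mul]
    exact ENNReal.mul_lt_top ENNReal.coe_lt_top htop.lt_top⟩
  refine integral_eq_orthAvg (ν := (ρ Set.univ)⁻¹ • ρ) μ (fun A => ?_) hw ?_
  · refine MeasurePreserving.smul_measure ?_ _
    have hpre : A ⁻¹' S = S := by ext z; simp [S]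
    have := (A.toIsometryEquiv.measurePreserving_hausdorffMeasure
      ((n : ℝ) - 1)).restrict_preimage (isClosed_sphere (x := 0) (ε := ‖y‖)).measurableSet
    change MeasurePreserving A (μH[(n : ℝ) - 1].restrict (A ⁻¹' S)) ρ at this
    rwa [hpre] at this
  · refine Measure.ae_smul_measure ?_ _
    filter_upwards [ae_restrict_mem (isClosed_sphere (x := 0) (ε := ‖y‖)).measurableSet] with z hz
    exact mem_sphere_zero_iff_norm.mp hz

end Sphere

theorem norm_gradient {F : Type*} [NormedAddCommGroup F] [InnerProductSpace ℝ F] [CompleteSpace F]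
    (f : F → ℝ) (x : F) : ‖gradient f x‖ = ‖fderiv ℝ f x‖ :=
  (InnerProductSpace.toDual ℝ F).symm.norm_map _

theorem lap_eq_laplacian {n : ℕ} {f : EuclideanSpace ℝ (Fin n) → ℝ}
    {x : EuclideanSpace ℝ (Fin n)} (hf : DifferentiableAt ℝ (fderiv ℝ f) x) :
    lap f x = Laplacian.laplacian f x := by
  rw [laplacian_eq_sum_fderiv_fderiv f (EuclideanSpace.basisFun (Fin n) ℝ), lap]
  refine Finset.sum_congr rfl fun i _ => ?_
  rw [fderiv_clm_apply hf (differentiableAt_const _)]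
  simp

theorem lap_congr {n : ℕ} {f g : EuclideanSpace ℝ (Fin n) → ℝ} {x : EuclideanSpace ℝ (Fin n)}
    (h : f =ᶠ[𝓝 x] g) : lap f x = lap g x := by
  refine Finset.sum_congr rfl fun i _ => ?_
  have hi : (fun y => fderiv ℝ f y (EuclideanSpace.single i 1)) =ᶠ[𝓝 x]
      fun y => fderiv ℝ g y (EuclideanSpace.single i 1) := by
    filter_upwards [h.fderiv (𝕜 := ℝ)] with y hy
    rw [hy]
  rw [hi.fderiv_eq]

/-- Nonnegativity of scalar curvature, `Δw + (m-1)‖∇w‖² ≤ 0`, is preserved by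
spherical averaging of the conformal factor. -/
theorem stmt_10 {m n : ℕ} (hm : 1 ≤ m) (hn : n = 2 * m)
    (w : EuclideanSpace ℝ (Fin n) → ℝ) (hw : ContDiff ℝ (⊤ : ℕ∞) w)
    (hscal : ∀ x, lap w x + ((m : ℝ) - 1) * ‖gradient w x‖ ^ 2 ≤ 0)
    (wbar : EuclideanSpace ℝ (Fin n) → ℝ)
    (hwbar : ∀ x, wbar x = sphereAvg (0 : EuclideanSpace ℝ (Fin n)) ‖x‖ w) :
    ∀ x : EuclideanSpace ℝ (Fin n), x ≠ 0 →
      lap wbar x + ((m : ℝ) - 1) * ‖gradient wbar x‖ ^ 2 ≤ 0 := by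
  intro x hx
  have hn1 : 1 ≤ n := by omega
  have hc : (0 : ℝ) ≤ (m : ℝ) - 1 := by simpa using hm
  by_cases hdeg : μH[(n : ℝ) - 1] (sphere (0 : EuclideanSpace ℝ (Fin n)) 1) = 0 ∨
      μH[(n : ℝ) - 1] (sphere (0 : EuclideanSpace ℝ (Fin n)) 1) = ⊤
  · have heq : wbar =ᶠ[𝓝 x] fun _ => 0 := by
      filter_upwards [isOpen_ne.mem_nhds hx] with y hy
      rw [hwbar, sphereAvg_eq_zero hn1 hdeg (norm_pos_iff.mpr hy)]
    rw [lap_congr heq, norm_gradient, heq.fderiv_eq]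
    simp [lap]
  · push Not at hdeg
    obtain ⟨μ, hμ, hμ'⟩ := exists_isProbabilityMeasure_isMulRightInvariant_unitary
      (E := EuclideanSpace ℝ (Fin n))
    have hw2 : ContDiff ℝ 2 w := contDiff_infty.mp hw 2
    have heq : wbar =ᶠ[𝓝 x] orthAvg μ w := by
      filter_upwards [isOpen_ne.mem_nhds hx] with y hy
      rw [hwbar, sphereAvg_eq_orthAvg hn1 hdeg.1 hdeg.2 μ hw.continuous hy]
    rw [lap_congr heq, norm_gradient, heq.fderiv_eq,
      lap_eq_laplacian (hasFDerivAt_fderiv_orthAvg μ hw2 x).differentiableAt]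
    refine laplacian_orthAvg_add_le μ hw2 hc (fun y => ?_) x
    have h1 : ContDiff ℝ 1 (fderiv ℝ w) := hw2.fderiv_right (by norm_num)
    rw [← lap_eq_laplacian (h1.differentiable one_ne_zero).differentiableAt, ← norm_gradient]
    exact hscal y
end
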